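/- The 𝔽₂-vector space (QP_5^0)_67 has dimension 460. -/

import Mathlib

open MvPolynomial

noncomputable section

/-- `P n` is the polynomial algebra `𝔽₂[x_1, …, x_n]`. -/
abbrev P (n : ℕ) : Type := MvPolynomial (Fin n) (ZMod 2)

/-- The total Steenrod square: the `𝔽₂`-algebra endomorphism of `P n`
with `Sq (x_j) = x_j + x_j ^ 2`. -/
def SqT (n : ℕ) : P n →ₐ[ZMod 2] P n := aeval fun j => X j + X j ^ 2

/-- `u` is hit (in degree `d`): `u = ∑_{i ≥ 1} Sq^i (f i)` where `f i` is homogeneous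
of degree `d - i`; here `Sq^i (f i)` is the degree-`d` homogeneous component of
`Sq (f i)`. -/
def IsHit (n d : ℕ) (u : P n) : Prop :=
  ∃ f : ℕ → P n,
    (∀ i, f i ∈ homogeneousSubmodule (Fin n) (ZMod 2) (d - i)) ∧
    u = ∑ i ∈ Finset.Icc 1 d, homogeneousComponent d (SqT n (f i))

/-- The homogeneous part `(P_n)_d`. -/
abbrev homSub (n d : ℕ) : Submodule (ZMod 2) (P n) := homogeneousSubmodule (Fin n) (ZMod 2) d

/-- The subspace of hit elements of degree `d` (the span of the set of hit elements;
this set is already closed under addition, so this is just the set of hit elements). -/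
def hitSub (n d : ℕ) : Submodule (ZMod 2) (P n) := Submodule.span (ZMod 2) {u | IsHit n d u}

/-- The cohit space `(QP_n)_d = (P_n)_d / (A⁺P_n)_d`. -/
abbrev QP (n d : ℕ) : Type :=
  ↥(homSub n d) ⧸ (hitSub n d).comap (homSub n d).subtype

/-- The class `[f]` in `(QP_n)_d` of a polynomial `f` (via its degree-`d` homogeneous
component; for `f` homogeneous of degree `d` this is the class of `f` itself). -/
def cls (n d : ℕ) (f : P n) : QP n d :=
  Submodule.Quotient.mk
    ⟨homogeneousComponent d f,
      (mem_homogeneousSubmodule _ _).2 (homogeneousComponent_isHomogeneous d f)⟩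

/-- The monomial `x^a = x_1^{a_1} ⋯ x_n^{a_n}`. -/
def mono {n : ℕ} (a : Fin n →₀ ℕ) : P n := monomial a 1

/-- The (total) degree of the monomial with exponent vector `a`. -/
def degA {n : ℕ} (a : Fin n →₀ ℕ) : ℕ := ∑ i, a i

/-- The weight vector: `wVec a t = ω_{t+1}(x^a) = ∑_j α_t(a_j)`. -/
def wVec {n : ℕ} (a : Fin n →₀ ℕ) : ℕ → ℕ :=
  fun t => ∑ j, if Nat.testBit (a j) t then 1 else 0

/-- Left lexicographic (strict) order on sequences. -/
def lexLtN (f g : ℕ → ℕ) : Prop := ∃ i, (∀ j, j < i → f j = g j) ∧ f i < g i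

/-- Left lexicographic (strict) order on exponent vectors. -/
def lexLtS {n : ℕ} (a b : Fin n →₀ ℕ) : Prop :=
  ∃ i : Fin n, (∀ j, j < i → a j = b j) ∧ a i < b i

/-- The order on monomials: `u < v` iff `ω(u) < ω(v)` lexicographically, or
`ω(u) = ω(v)` and `σ(u) < σ(v)` lexicographically. -/
def monLt {n : ℕ} (a b : Fin n →₀ ℕ) : Prop :=
  lexLtN (wVec a) (wVec b) ∨ (wVec a = wVec b ∧ lexLtS a b)

/-- A monomial is admissible iff it is not inadmissible, i.e. there is no finite set of
monomials of the same degree, all smaller than it, such that subtracting their sum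
yields a hit polynomial. -/
def Admissible {n : ℕ} (a : Fin n →₀ ℕ) : Prop :=
  ¬ ∃ S : Finset (Fin n →₀ ℕ),
      (∀ b ∈ S, degA b = degA a ∧ monLt b a) ∧
      IsHit n (degA a) (mono a - ∑ b ∈ S, mono b)

/-- `P_n^0`: the span of the monomials in which some variable has exponent `0`. -/
def PzeroSub (n : ℕ) : Submodule (ZMod 2) (P n) :=
  Submodule.span (ZMod 2) {x : P n | ∃ a : Fin n →₀ ℕ, (∃ i, a i = 0) ∧ x = mono a}

/-- `P_n^+`: the span of the monomials in which every variable occurs. -/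
def PplusSub (n : ℕ) : Submodule (ZMod 2) (P n) :=
  Submodule.span (ZMod 2) {x : P n | ∃ a : Fin n →₀ ℕ, (∀ i, 0 < a i) ∧ x = mono a}

/-- `(QP_n^0)_d`: the image of `(P_n^0)_d` in `(QP_n)_d`. -/
def Qzero (n d : ℕ) : Submodule (ZMod 2) (QP n d) :=
  (((PzeroSub n).comap (homSub n d).subtype)).map
    ((hitSub n d).comap (homSub n d).subtype).mkQ

/-- `(QP_n^+)_d`: the image of `(P_n^+)_d` in `(QP_n)_d`. -/
def Qplus (n d : ℕ) : Submodule (ZMod 2) (QP n d) :=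
  (((PplusSub n).comap (homSub n d).subtype)).map
    ((hitSub n d).comap (homSub n d).subtype).mkQ

/-- Kameko-type map `S_5 : P_5 → P_5`, the `𝔽₂`-linear map with
`S_5(x_1x_2x_3x_4x_5 · y²) = y` on monomials of that form and `S_5 = 0` on all
other monomials. -/
def S5 : P 5 →ₗ[ZMod 2] P 5 :=
  (basisMonomials (Fin 5) (ZMod 2)).constr (ZMod 2) fun a =>
    if ∀ i, Odd (a i) then mono (Finsupp.equivFunOnFinite.symm fun i => a i / 2) else 0

/-- `Φ(f) = x_1x_2x_3x_4x_5 · f²`. -/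
def Phi (f : P 5) : P 5 := (∏ i : Fin 5, X i) * f ^ 2

section general

variable {n : ℕ} {Q : Type*} [AddCommGroup Q] [Module (ZMod 2) Q]

/-- `φ` is concentrated in degree `d`. -/
def SuppD (d : ℕ) (φ : P n →ₗ[ZMod 2] Q) : Prop :=
  ∀ a : Fin n →₀ ℕ, a.degree ≠ d → φ (monomial a 1) = 0

/-- `φ` is concentrated in degree `d` and kills hit elements. -/
def Hd (d : ℕ) (φ : P n →ₗ[ZMod 2] Q) : Prop :=
  SuppD d φ ∧ ∀ a : Fin n →₀ ℕ, a.degree < d → φ (SqT n (monomial a 1)) = 0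

lemma sqT_X (j : Fin n) : SqT n (X j) = X j + X j ^ 2 := by simp [SqT]

lemma add_self2 (x : Q) : x + x = 0 := ZModModule.add_self x

lemma eq_of_add2 {x y : Q} (h : x + y = 0) : x = y := by
  have := add_self2 y
  calc x = x + (y + y) := by rw [this, add_zero]
    _ = (x + y) + y := by abel
    _ = y := by rw [h, zero_add]

lemma mon_eq (a : Fin n →₀ ℕ) : (monomial a (1 : ZMod 2) : P n) = ∏ i, X i ^ a i := by
  rw [MvPolynomial.monomial_eq, Finsupp.prod_fintype _ _ (by simp)]
  simp

lemma sqT_mon (a : Fin n →₀ ℕ) : SqT n (monomial a 1) =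
    ∑ k ∈ Fintype.piFinset (fun i => Finset.range (a i + 1)),
      (∏ i, ((a i).choose (k i) : ZMod 2)) •
        (monomial (a + Finsupp.equivFunOnFinite.symm k) 1 : P n) := by
  rw [mon_eq, map_prod]
  have h : ∀ i, SqT n (X i ^ a i) = ∑ k ∈ Finset.range (a i + 1),
      ((a i).choose k : P n) * X i ^ (a i + k) := by
    intro i
    rw [map_pow, sqT_X, add_comm, add_pow]
    refine Finset.sum_congr rfl fun k hk => ?_
    have : k ≤ a i := by simpa [Nat.lt_succ_iff] using hk
    rw [mul_comm, ← pow_mul, ← pow_add]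
    congr 2; omega
  simp_rw [h]
  rw [Finset.prod_univ_sum]
  refine Finset.sum_congr rfl fun k _ => ?_
  rw [Finset.prod_mul_distrib, mon_eq, smul_eq_C_mul, map_prod]
  simp

lemma deg_fun (k : Fin n → ℕ) : (Finsupp.equivFunOnFinite.symm k).degree = ∑ i, k i := by
  rw [Finsupp.degree_eq_sum]; simp

lemma sqK {d e : ℕ} {φ : P n →ₗ[ZMod 2] Q} (hφ : SuppD d φ) (a : Fin n →₀ ℕ)
    (h : a.degree + e = d) :
    φ (SqT n (monomial a 1)) = ∑ k ∈ Finset.piAntidiag (Finset.univ : Finset (Fin n)) e,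
      (∏ i, ((a i).choose (k i) : ZMod 2)) •
        φ (monomial (a + Finsupp.equivFunOnFinite.symm k) 1) := by
  rw [sqT_mon, map_sum]
  simp_rw [map_smul]
  have h1 : ∀ k : Fin n → ℕ, φ (monomial (a + Finsupp.equivFunOnFinite.symm k) 1) ≠ 0 →
      ∑ i, k i = e := by
    intro k hk
    by_contra hne
    apply hk
    apply hφ
    rw [map_add, deg_fun]; omega
  have h2 : ∀ k : Fin n → ℕ, (∏ i, ((a i).choose (k i) : ZMod 2)) ≠ 0 → ∀ i, k i ≤ a i := by
    intro k hk i
    by_contra hne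
    apply hk
    apply Finset.prod_eq_zero (Finset.mem_univ i)
    rw [Nat.choose_eq_zero_of_lt (by omega)]; simp
  rw [← Finset.sum_filter_of_ne (p := fun k => ∑ i, k i = e),
    ← Finset.sum_filter_of_ne (s := Finset.piAntidiag _ _) (p := fun k => ∀ i, k i ≤ a i)]
  · refine Finset.sum_congr ?_ fun _ _ => rfl
    ext k
    simp [and_comm]
  · intro k _ hk
    exact h2 k (left_ne_zero_of_smul hk)
  · intro k _ hk
    exact h1 k (right_ne_zero_of_smul hk)

lemma low0 {d : ℕ} {φ : P n →ₗ[ZMod 2] Q} (hφ : SuppD d φ) (a : Fin n →₀ ℕ)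
    (h : a.degree = d) : φ (SqT n (monomial a 1)) = φ (monomial a 1) := by
  rw [sqK hφ a (e := 0) (by omega), Finset.piAntidiag_zero]
  have h0 : Finsupp.equivFunOnFinite.symm (0 : Fin n → ℕ) = 0 := by ext; simp
  simp [h0]

lemma topS {d : ℕ} {φ : P n →ₗ[ZMod 2] Q} (hφ : SuppD d φ) (a : Fin n →₀ ℕ)
    (h : 2 * a.degree = d) : φ (SqT n (monomial a 1)) = φ (monomial a 1 ^ 2) := by
  rw [sqK hφ a (e := a.degree) (by omega), Finset.sum_eq_single (a : Fin n → ℕ)]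
  · simp [monomial_pow, two_smul]
  · intro k hk hne
    rw [Finset.mem_piAntidiag] at hk
    have : ∃ i, a i < k i := by
      by_contra hcon
      push Not at hcon
      apply hne
      have h3 : ∑ i, k i = ∑ i, a i := by rw [hk.1, Finsupp.degree_eq_sum]
      have := (Finset.sum_eq_sum_iff_of_le (fun i _ => hcon i)).1 h3
      funext i; exact this i (Finset.mem_univ i)
    obtain ⟨i, hi⟩ := this
    rw [Finset.prod_eq_zero (Finset.mem_univ i), zero_smul]
    rw [Nat.choose_eq_zero_of_lt hi]; simp
  · intro hk
    exfalso; apply hk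
    simp [Finset.mem_piAntidiag, Finsupp.degree_eq_sum]

lemma lin_zero {φ : P n →ₗ[ZMod 2] Q} (h : ∀ a, φ (monomial a 1) = 0) (f : P n) : φ f = 0 := by
  rw [f.as_sum, map_sum]
  refine Finset.sum_eq_zero fun a _ => ?_
  have h1 : (monomial a (coeff a f) : P n) = (coeff a f) • monomial a 1 := by
    rw [smul_monomial]; simp
  rw [h1, map_smul, h a, smul_zero]

lemma lin_zero_hom {d : ℕ} {φ : P n →ₗ[ZMod 2] Q}
    (h : ∀ a : Fin n →₀ ℕ, a.degree = d → φ (monomial a 1) = 0) (f : P n)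
    (hf : f.IsHomogeneous d) : φ f = 0 := by
  rw [f.as_sum, map_sum]
  refine Finset.sum_eq_zero fun a ha => ?_
  have h1 : (monomial a (coeff a f) : P n) = (coeff a f) • monomial a 1 := by
    rw [smul_monomial]; simp
  rw [h1, map_smul, h a, smul_zero]
  have := hf (mem_support_iff.1 ha)
  rw [Finsupp.degree_eq_weight_one]; exact this

lemma SuppD.hom {d e : ℕ} {φ : P n →ₗ[ZMod 2] Q} (hφ : SuppD d φ) {f : P n}
    (hf : f.IsHomogeneous e) (he : e ≠ d) : φ f = 0 :=
  lin_zero_hom (fun a ha => hφ a (by omega)) f hf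

lemma Hd.hom {d e : ℕ} {φ : P n →ₗ[ZMod 2] Q} (hφ : Hd d φ) {f : P n}
    (hf : f.IsHomogeneous e) (he : e < d) : φ (SqT n f) = 0 :=
  lin_zero_hom (φ := φ ∘ₗ (SqT n).toLinearMap) (fun a ha => hφ.2 a (by omega)) f hf

/-- The functional `y ↦ φ (p * y ^ 2)`. -/
def pull (p : P n) (φ : P n →ₗ[ZMod 2] Q) : P n →ₗ[ZMod 2] Q where
  toFun y := φ (p * y ^ 2)
  map_add' y z := by rw [CharTwo.add_sq, mul_add, map_add]
  map_smul' c y := by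
    have : c ^ 2 = c := ZMod.pow_card c
    rw [smul_pow, this, mul_smul_comm, map_smul]; rfl

lemma pull_apply (p : P n) (φ : P n →ₗ[ZMod 2] Q) (y : P n) : pull p φ y = φ (p * y ^ 2) := rfl

lemma homM (a : Fin n →₀ ℕ) : (monomial a (1 : ZMod 2) : P n).IsHomogeneous a.degree :=
  isHomogeneous_monomial _ rfl

lemma pull_supp {d e m : ℕ} {φ : P n →ₗ[ZMod 2] Q} (hφ : SuppD d φ) {p : P n}
    (hp : p.IsHomogeneous e) (h : e + 2 * m = d) : SuppD m (pull p φ) := by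
  intro a ha
  rw [pull_apply]
  refine hφ.hom (e := e + a.degree * 2) (hp.mul ((homM a).pow 2)) (by omega)

lemma pull_parity {d e : ℕ} {φ : P n →ₗ[ZMod 2] Q} (hφ : SuppD d φ) {p : P n}
    (hp : p.IsHomogeneous e) (h : e % 2 ≠ d % 2) (y : P n) : φ (p * y ^ 2) = 0 := by
  refine lin_zero (φ := pull p φ) (fun a => ?_) y
  rw [pull_apply]
  refine hφ.hom (e := e + a.degree * 2) (hp.mul ((homM a).pow 2)) (by omega)

lemma mul_supp {d e m : ℕ} {φ : P n →ₗ[ZMod 2] Q} (hφ : SuppD d φ) {p : P n}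
    (hp : p.IsHomogeneous e) (h : e + m = d) :
    SuppD m (φ ∘ₗ LinearMap.mulLeft (ZMod 2) p) := by
  intro a ha
  exact hφ.hom (e := e + a.degree) (hp.mul (homM a)) (by omega)

lemma hX (j : Fin n) : (X j : P n).IsHomogeneous 1 := isHomogeneous_X _ _

end general

section star

/-- unit exponent vectors -/
def ee (v : Fin 4) : Fin 4 → ℕ := fun w => if w = v then 1 else 0

/-- indicator of the complement of `l` -/
def cc (l : Fin 4) : Fin 4 → ℕ := fun w => if w = l then 0 else 1

def sp (a : Fin 4 → ℕ) : Finset (Fin 4) := Finset.univ.filter fun v => 0 < a v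

lemma mem_sp {a : Fin 4 → ℕ} {v : Fin 4} : v ∈ sp a ↔ 0 < a v := by simp [sp]

def dg (a : Fin 4 → ℕ) : ℕ := ∑ v, a v

lemma dg_add (a b : Fin 4 → ℕ) : dg (a + b) = dg a + dg b := by
  simp [dg, Finset.sum_add_distrib]

lemma dg_ee (v : Fin 4) : dg (ee v) = 1 := by simp [dg, ee]

lemma dg_two (a : Fin 4 → ℕ) : dg (2 • a) = 2 * dg a := by
  simp [dg, Finset.mul_sum]

lemma dg_cc (l : Fin 4) : dg (cc l) = 3 := by revert l; decide

variable {Q : Type*} [AddCommGroup Q] [Module (ZMod 2) Q]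

lemma SL (M : ℕ) (h : (Fin 4 → ℕ) → Q)
    (hh : ∀ v i j, i ≠ j → dg v + 3 = M → h (v + ee i + 2 • ee j) = h (v + 2 • ee i + ee j)) :
    ∀ a b, dg a = M → dg b = M → sp a = sp b → h a = h b := by
  have key : ∀ D : ℕ, ∀ a b, (∑ v, (a v - b v)) = D → dg a = M → dg b = M → sp a = sp b →
      h a = h b := by
    intro D
    induction D with
    | zero =>
      intro a b hD ha hb _
      have h1 : ∀ v, a v ≤ b v := by
        intro v
        have := (Finset.sum_eq_zero_iff.1 hD) v (Finset.mem_univ v)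
        omega
      have h2 : ∀ v ∈ Finset.univ, a v = b v :=
        (Finset.sum_eq_sum_iff_of_le (fun i _ => h1 i)).1 (ha.trans hb.symm)
      have : a = b := funext fun v => h2 v (Finset.mem_univ v)
      rw [this]
    | succ D ih =>
      intro a b hD ha hb hs
      have hi : ∃ i, b i < a i := by
        by_contra hcon
        push Not at hcon
        have : ∑ v, (a v - b v) = 0 := Finset.sum_eq_zero fun v _ => by
          have := hcon v; omega
        omega
      obtain ⟨i, hi⟩ := hi
      have hj : ∃ j, a j < b j := by
        by_contra hcon
        push Not at hcon
        have := Finset.sum_lt_sum (s := Finset.univ) (fun v _ => hcon v) ⟨i, Finset.mem_univ i, hi⟩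
        unfold dg at ha hb
        omega
      obtain ⟨j, hj⟩ := hj
      have hij : i ≠ j := by rintro rfl; omega
      have hbi : 0 < b i := by rw [← mem_sp, ← hs, mem_sp]; omega
      have haj : 0 < a j := by rw [← mem_sp, hs, mem_sp]; omega
      let v : Fin 4 → ℕ := fun w => if w = i then a i - 2 else if w = j then a j - 1 else a w
      have e1 : a = v + 2 • ee i + ee j := by
        funext w
        simp only [v, ee, Pi.add_apply, Pi.smul_apply, smul_eq_mul]
        by_cases h1 : w = i
        · subst h1; simp [hij]; omega
        · by_cases h2 : w = j
          · subst h2; simp [h1]; omega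
          · simp [h1, h2]
      have dv : dg v + 3 = M := by
        have := ha
        rw [e1, dg_add, dg_add, dg_two, dg_ee, dg_ee] at this
        omega
      rw [e1, ← hh v i j hij dv]
      apply ih
      · have e2 : ∀ w, a w - b w = ((v + ee i + 2 • ee j) w - b w) + ee i w := by
          intro w
          have := congrFun e1 w
          simp only [ee, Pi.add_apply, Pi.smul_apply, smul_eq_mul] at this ⊢
          by_cases h1 : w = i
          · subst h1; simp [hij] at this ⊢; omega
          · by_cases h2 : w = j
            · subst h2; simp [h1] at this ⊢; omega
            · simp [h1, h2] at this ⊢; omega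
        simp_rw [e2] at hD
        rw [Finset.sum_add_distrib] at hD
        have := dg_ee i
        unfold dg at this
        omega
      · rw [dg_add, dg_add, dg_two, dg_ee, dg_ee]; omega
      · exact hb
      · rw [← hs]
        ext w
        rw [mem_sp, mem_sp, e1]
        simp only [ee, Pi.add_apply, Pi.smul_apply, smul_eq_mul]
        split_ifs <;> omega
  intro a b ha hb hs
  exact key _ a b rfl ha hb hs

lemma KL (N : ℕ) (G : Fin 4 → (Fin 4 → ℕ) → Q)
    (R1 : ∀ i j u, dg u + 1 = N → G j (u + ee i) = G i (u + ee j))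
    (R2 : ∀ i a, dg a + 1 = N → ∑ v, ((a v : ℕ) : ZMod 2) • G i (a + ee v) = 0) :
    ∃ T : Finset (Fin 4) → Q, ∀ i a, dg a = N → G i a = T (insert i (sp a)) := by
  classical
  obtain ⟨θ, hθ⟩ : ∃ θ : (Fin 4 → ℕ) → Q, ∀ i a, dg a = N → θ (a + ee i) = G i a := by
    refine ⟨fun c => if h : ∃ i, 0 < c i then G h.choose (c - ee h.choose) else 0, ?_⟩
    intro i a ha
    have hex : ∃ j, 0 < (a + ee i) j := ⟨i, by simp [ee]⟩
    simp only [dif_pos hex]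
    have hj := hex.choose_spec
    generalize hex.choose = j at hj
    by_cases hij : j = i
    · subst hij
      congr 1
      funext w; simp
    · have haj : 0 < a j := by simpa [ee, hij] using hj
      have e1 : a = (a - ee j) + ee j := by
        funext w
        simp only [ee, Pi.add_apply, Pi.sub_apply]
        split_ifs with h
        · subst h; omega
        · omega
      have e2 : a + ee i - ee j = (a - ee j) + ee i := by
        funext w
        simp only [ee, Pi.add_apply, Pi.sub_apply]
        split_ifs with h h' <;> first | (subst h; omega) | (subst h'; omega) | omega
      rw [e2]
      conv_rhs => rw [e1]
      apply R1
      rw [e1, dg_add, dg_ee] at ha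
      exact ha
  have hsl := SL (N + 1) θ (by
    intro v i j hij hv
    have key : ∀ i' : Fin 4, i' = i ∨ i' = j →
        θ (v + ee i + ee j + ee i') = ∑ w, (((v + ee i + ee j) w : ℕ) : ZMod 2) •
          θ (v + ee i + ee j + ee w) := by
      intro i' hi'
      obtain ⟨u, hu⟩ : ∃ u, v + ee i + ee j = u + ee i' := by
        rcases hi' with rfl | rfl
        · exact ⟨v + ee j, by abel⟩
        · exact ⟨v + ee i, rfl⟩
      have du : dg u + 1 = N := by
        have := congrArg dg hu
        rw [dg_add, dg_add, dg_add, dg_ee, dg_ee, dg_ee] at this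
        omega
      have h2 := R2 i' u du
      have h3 : ∀ w, θ (u + ee i' + ee w) = G i' (u + ee w) := by
        intro w
        rw [← hθ i' _ (by rw [dg_add, dg_ee, du])]
        congr 1; abel
      rw [hu]
      simp only [Pi.add_apply, Nat.cast_add, add_smul, Finset.sum_add_distrib]
      simp only [h3, h2, zero_add]
      simp [ee]
    have k1 := key i (Or.inl rfl)
    have k2 := key j (Or.inr rfl)
    have e1 : v + ee i + 2 • ee j = v + ee i + ee j + ee j := by rw [two_smul]; abel
    have e2 : v + 2 • ee i + ee j = v + ee i + ee j + ee i := by rw [two_smul]; abel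
    rw [e1, e2, k1, k2])
  refine ⟨fun U => if h : ∃ c, dg c = N + 1 ∧ sp c = U then θ h.choose else 0, ?_⟩
  intro i a ha
  have hs : sp (a + ee i) = insert i (sp a) := by
    ext w
    rw [Finset.mem_insert, mem_sp, mem_sp]
    simp only [ee, Pi.add_apply]
    split_ifs with h <;> simp [h]
  have hex : ∃ c, dg c = N + 1 ∧ sp c = insert i (sp a) :=
    ⟨a + ee i, by rw [dg_add, dg_ee, ha], hs⟩
  simp only [dif_pos hex]
  rw [← hθ i a ha]
  apply hsl
  · rw [dg_add, dg_ee, ha]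
  · exact hex.choose_spec.1
  · rw [hs]; exact hex.choose_spec.2.symm

end star

section star2

variable {Q : Type*} [AddCommGroup Q] [Module (ZMod 2) Q]

lemma choose2_mod (s a : ℕ) (hs : s ≤ 1) : (((s + 2 * a).choose 2 : ℕ) : ZMod 2) = (a : ZMod 2) := by
  have h2 : (2 : ZMod 2) = 0 := by decide
  have h : (s + 2 * a).choose 2 + (2 * a * (1 - s)) = a + 2 * (a * a) := by
    rw [Nat.choose_two_right]
    interval_cases s
    · rcases a with _ | a
      · rfl
      · have : (0 + 2 * (a + 1)) * (0 + 2 * (a + 1) - 1) = ((a + 1) * (2 * a + 1)) * 2 := by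
          have : 0 + 2 * (a + 1) - 1 = 2 * a + 1 := by omega
          rw [this]; ring
        rw [this, Nat.mul_div_cancel _ (by norm_num)]
        simp only [Nat.sub_zero]
        ring
    · have : (1 + 2 * a) * (1 + 2 * a - 1) = ((1 + 2 * a) * a) * 2 := by
        have : 1 + 2 * a - 1 = 2 * a := by omega
        rw [this]; ring
      rw [this, Nat.mul_div_cancel _ (by norm_num)]
      simp only [Nat.sub_self]
      ring
  have := congrArg (Nat.cast (R := ZMod 2)) h
  push_cast at this
  simpa [h2] using this

/-- hypotheses of the star theorem for one functional -/
structure OneH (g : (Fin 4 → ℕ) → Q) : Prop where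
  L1 : ∀ b, dg b = 14 → ∑ v, ((b v : ℕ) : ZMod 2) • g (b + ee v) = 0
  L2 : ∀ b, dg b = 13 → ∑ v, (((b v).choose 2 : ℕ) : ZMod 2) • g (b + 2 • ee v) +
    ∑ u, ∑ v, (if u < v then ((b u * b v : ℕ) : ZMod 2) • g (b + ee u + ee v) else 0) = 0

variable {g : (Fin 4 → ℕ) → Q}

lemma OneH.R1 (hg : OneH g) (i j : Fin 4) (a : Fin 4 → ℕ) (ha : dg a + 1 = 7) :
    g (ee j + 2 • (a + ee i)) = g (ee i + 2 • (a + ee j)) := by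
  have h2 : (2 : ZMod 2) = 0 := by decide
  have h := hg.L1 (ee i + ee j + 2 • a) (by rw [dg_add, dg_add, dg_ee, dg_ee, dg_two]; omega)
  have hc : ∀ v, (((ee i + ee j + 2 • a) v : ℕ) : ZMod 2) =
      (if v = i then 1 else 0) + (if v = j then 1 else 0) := by
    intro v
    simp [ee, h2]
  simp only [hc, add_smul, Finset.sum_add_distrib, ite_smul, one_smul, zero_smul] at h
  simp only [Finset.sum_ite_eq', Finset.mem_univ, if_true] at h
  have e1 : ee j + 2 • (a + ee i) = ee i + ee j + 2 • a + ee i := by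
    rw [smul_add, two_smul ℕ (ee i)]; abel
  have e2 : ee i + 2 • (a + ee j) = ee i + ee j + 2 • a + ee j := by
    rw [smul_add, two_smul ℕ (ee j)]; abel
  rw [e1, e2]
  exact eq_of_add2 h

lemma OneH.R2 (hg : OneH g) (i : Fin 4) (a : Fin 4 → ℕ) (ha : dg a + 1 = 7) :
    ∑ v, ((a v : ℕ) : ZMod 2) • g (ee i + 2 • (a + ee v)) = 0 := by
  have h2 : (2 : ZMod 2) = 0 := by decide
  have h := hg.L2 (ee i + 2 • a) (by rw [dg_add, dg_ee, dg_two]; omega)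
  rw [Finset.sum_eq_zero (s := Finset.univ) (f := fun u => ∑ v, _) , add_zero] at h
  · rw [← h]
    refine Finset.sum_congr rfl fun v _ => ?_
    have : (ee i + 2 • a) v = ee i v + 2 * a v := by simp
    rw [this, choose2_mod _ _ (by unfold ee; split_ifs <;> simp)]
    congr 2; rw [smul_add]; abel
  · intro u _
    refine Finset.sum_eq_zero fun v _ => ?_
    split_ifs with huv
    · have : (((ee i + 2 • a) u * (ee i + 2 • a) v : ℕ) : ZMod 2) = 0 := by
        simp only [ee, Pi.add_apply, Pi.smul_apply, smul_eq_mul]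
        push_cast
        simp only [h2]
        by_cases h1 : u = i
        · subst h1; simp [huv.ne']
        · simp [h1]
      rw [this, zero_smul]
    · rfl

lemma OneH.R4 (hg : OneH g) (a : Fin 4 → ℕ) (ha : dg a = 5) :
    ∑ l, g (cc l + 2 • (a + ee l)) = 0 := by
  have h2 : (2 : ZMod 2) = 0 := by decide
  have h := hg.L1 (1 + 2 • a) (by
    rw [dg_add, dg_two]
    have : dg 1 = 4 := by decide
    omega)
  rw [← h]
  refine Finset.sum_congr rfl fun l _ => ?_
  have : ((((1 : Fin 4 → ℕ) + 2 • a) l : ℕ) : ZMod 2) = 1 := by simp [h2]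
  rw [this, one_smul]
  congr 1
  funext w
  simp only [cc, ee, Pi.add_apply, Pi.smul_apply, smul_eq_mul, Pi.one_apply]
  split_ifs <;> omega

lemma OneH.R3 (hg : OneH g) (l : Fin 4) (a : Fin 4 → ℕ) (ha : dg a = 5) :
    ∑ v, ((a v : ℕ) : ZMod 2) • g (cc l + 2 • (a + ee v)) +
    ∑ u, ∑ v, (if u < v ∧ u ≠ l ∧ v ≠ l then g (cc l + 2 • a + ee u + ee v) else 0) = 0 := by
  have h2 : (2 : ZMod 2) = 0 := by decide
  have h := hg.L2 (cc l + 2 • a) (by rw [dg_add, dg_cc, dg_two]; omega)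
  refine Eq.trans ?_ h
  congr 1
  · refine Finset.sum_congr rfl fun v _ => ?_
    have : (cc l + 2 • a) v = cc l v + 2 * a v := by simp
    rw [this, choose2_mod _ _ (by unfold cc; split_ifs <;> simp)]
    congr 2; rw [smul_add]; abel
  · refine Finset.sum_congr rfl fun u _ => Finset.sum_congr rfl fun v _ => ?_
    have : (((cc l + 2 • a) u * (cc l + 2 • a) v : ℕ) : ZMod 2) =
        if u ≠ l ∧ v ≠ l then 1 else 0 := by
      simp only [cc, Pi.add_apply, Pi.smul_apply, smul_eq_mul]
      push_cast
      simp only [h2]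
      by_cases h1 : u = l <;> by_cases h3 : v = l <;> simp [h1, h3]
    rw [this]
    by_cases h1 : u < v <;> by_cases h3 : u ≠ l ∧ v ≠ l
    · rw [if_pos ⟨h1, h3⟩, if_pos h1, if_pos h3, one_smul]
    · rw [if_neg (by tauto), if_pos h1, if_neg h3, zero_smul]
    · rw [if_neg (by tauto), if_neg h1]
    · rw [if_neg (by tauto), if_neg h1]

lemma sp_two_ee (i : Fin 4) (a : Fin 4 → ℕ) : sp (ee i + 2 • a) = insert i (sp a) := by
  ext w
  rw [Finset.mem_insert, mem_sp, mem_sp]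
  simp only [ee, Pi.add_apply, Pi.smul_apply, smul_eq_mul]
  split_ifs with h <;> simp [h]

lemma sp_add_ee (i : Fin 4) (a : Fin 4 → ℕ) : sp (a + ee i) = insert i (sp a) := by
  ext w
  rw [Finset.mem_insert, mem_sp, mem_sp]
  simp only [ee, Pi.add_apply]
  split_ifs with h <;> simp [h]

lemma sp_two_cc (i : Fin 4) (a : Fin 4 → ℕ) : sp (cc i + 2 • a) = {i}ᶜ ∪ (sp a) := by
  ext w
  rw [Finset.mem_union, Finset.mem_compl, Finset.mem_singleton, mem_sp, mem_sp]
  simp only [cc, Pi.add_apply, Pi.smul_apply, smul_eq_mul]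
  split_ifs with h <;> simp [h]

lemma OneH.exT (hg : OneH g) : ∃ T : Finset (Fin 4) → Q,
    ∀ i a, dg a = 7 → g (ee i + 2 • a) = T (insert i (sp a)) :=
  KL 7 (fun i a => g (ee i + 2 • a)) hg.R1 hg.R2

lemma three_smul2 (x : Q) : x + x + x = x := by rw [add_self2, zero_add]

/-- sum over `a_v` of an expression depending on `sp a` -/
lemma sum_sp {a : Fin 4 → ℕ} (ha : dg a = 5) (F : Finset (Fin 4) → Q) :
    ∑ v, ((a v : ℕ) : ZMod 2) • F (sp (a + ee v)) = F (sp a) := by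
  have h : ∀ v, ((a v : ℕ) : ZMod 2) • F (sp (a + ee v)) = ((a v : ℕ) : ZMod 2) • F (sp a) := by
    intro v
    by_cases hv : a v = 0
    · simp [hv]
    · rw [sp_add_ee, Finset.insert_eq_of_mem (mem_sp.2 (by omega))]
  simp_rw [h]
  rw [← Finset.sum_smul, ← Nat.cast_sum]
  have : ∑ v, a v = 5 := ha
  rw [this]
  have h5 : ((5 : ℕ) : ZMod 2) = 1 := by decide
  rw [h5, one_smul]

lemma OneH.R3' (hg : OneH g) {T : Finset (Fin 4) → Q}
    (hT : ∀ i a, dg a = 7 → g (ee i + 2 • a) = T (insert i (sp a)))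
    (l : Fin 4) (a : Fin 4 → ℕ) (ha : dg a = 5) :
    ∑ v, ((a v : ℕ) : ZMod 2) •
      (g (cc l + 2 • (a + ee v)) + T ({l}ᶜ ∪ sp (a + ee v))) = 0 := by
  have h := hg.R3 l a ha
  simp only [smul_add (_ : ZMod 2), Finset.sum_add_distrib]
  rw [sum_sp ha (fun V => T ({l}ᶜ ∪ V))]
  refine Eq.trans ?_ h
  congr 1
  have key : ∀ i u v : Fin 4, i ≠ u → i ≠ v → u ≠ v → i ≠ l → u ≠ l → v ≠ l →
      g (cc l + 2 • a + ee u + ee v) = T ({l}ᶜ ∪ sp a) := by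
    intro i u v h1 h2 h3 h4 h5 h6
    have e1 : cc l + 2 • a + ee u + ee v = ee i + 2 • (a + ee u + ee v) := by
      have : cc l = ee i + ee u + ee v := by
        funext w
        clear hT h
        revert i u v l w
        decide
      rw [this, smul_add, smul_add, two_smul ℕ (ee u), two_smul ℕ (ee v)]
      abel
    rw [e1, hT _ _ (by rw [dg_add, dg_add, dg_ee, dg_ee, ha]), sp_add_ee, sp_add_ee]
    congr 1
    have : ({l}ᶜ : Finset (Fin 4)) = {i, v, u} := by
      clear e1 hT h
      revert i u v l; decide
    rw [this]
    ext w; simp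
  have hk : ∀ u v : Fin 4, (if u < v ∧ u ≠ l ∧ v ≠ l then g (cc l + 2 • a + ee u + ee v) else 0)
      = if u < v ∧ u ≠ l ∧ v ≠ l then T ({l}ᶜ ∪ sp a) else 0 := by
    intro u v
    split_ifs with huv
    · obtain ⟨i, hi⟩ : ∃ i : Fin 4, i ≠ u ∧ i ≠ v ∧ i ≠ l := by
        clear hT h key
        revert u v l; decide
      exact key i u v hi.1 hi.2.1 huv.1.ne hi.2.2 huv.2.1 huv.2.2
    · rfl
  rw [Finset.sum_congr rfl fun u _ => Finset.sum_congr rfl fun v _ => hk u v]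
  generalize T ({l}ᶜ ∪ sp a) = x
  have := three_smul2 x
  fin_cases l <;> simp [Fin.sum_univ_four] <;> simpa [add_assoc] using this.symm

end star2

section star3

variable {Q : Type*} [AddCommGroup Q] [Module (ZMod 2) Q]

structure StarH (g : Fin 4 → Fin 4 → (Fin 4 → ℕ) → Q) : Prop where
  one : ∀ j k, OneH (g j k)
  symm : ∀ j k, g j k = g k j
  diag : ∀ j b, g j j b = 0
  C2 : ∀ j k l y, dg y = 14 → g j k (y + ee l) + g j l (y + ee k) + g k l (y + ee j) = 0

lemma exists_v7 (V : Finset (Fin 4)) (hV : V.Nonempty) : ∃ v, dg v = 7 ∧ sp v = V := by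
  have : ∀ V : Finset (Fin 4), V.Nonempty → ∃ t ∈ V,
      ∑ w, (if w = t then 8 - V.card else if w ∈ V then 1 else 0) = 7 ∧ V.card < 8 := by decide
  obtain ⟨t, ht, h, hc⟩ := this V hV
  refine ⟨fun w => if w = t then 8 - V.card else if w ∈ V then 1 else 0, h, ?_⟩
  ext w
  rw [mem_sp]
  split_ifs with h1 h2
  · subst h1; simp [ht, hc]
  · simp [h2]
  · simp [h2]

lemma exists_c15 (V : Finset (Fin 4)) (hV : V.Nonempty) : ∃ v, dg v = 15 ∧ sp v = V := by
  have : ∀ V : Finset (Fin 4), V.Nonempty → ∃ t ∈ V,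
      ∑ w, (if w = t then 16 - V.card else if w ∈ V then 1 else 0) = 15 ∧ V.card < 8 := by decide
  obtain ⟨t, ht, h, hc⟩ := this V hV
  refine ⟨fun w => if w = t then 16 - V.card else if w ∈ V then 1 else 0, h, ?_⟩
  ext w
  rw [mem_sp]
  split_ifs with h1 h2
  · subst h1; simp [ht]; omega
  · simp [h2]
  · simp [h2]

lemma add_self_left2 (x y : Q) : x + (x + y) = y := by rw [← add_assoc, add_self2, zero_add]

lemma vec_cases (b : Fin 4 → ℕ) (hb : dg b = 15) :
    (∃ i a, dg a = 7 ∧ b = ee i + 2 • a) ∨ (∃ l a, dg a = 6 ∧ b = cc l + 2 • a) := by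
  have h0 : b = (fun v => b v % 2) + 2 • (fun v => b v / 2) := by
    funext v; simp; omega
  have hd : dg b = dg (fun v => b v % 2) + 2 * dg (fun v => b v / 2) := by
    conv_lhs => rw [h0, dg_add, dg_two]
  have key : ∀ s : Fin 4 → Fin 2, (∑ v, (s v : ℕ)) % 2 = 1 →
      (∃ i, ∀ v, (s v : ℕ) = ee i v) ∨ (∃ l, ∀ v, (s v : ℕ) = cc l v) := by decide
  have hk := key (fun v => ⟨b v % 2, Nat.mod_lt _ (by norm_num)⟩) (by
    change dg (fun v => b v % 2) % 2 = 1
    omega)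
  rcases hk with ⟨i, hi⟩ | ⟨l, hl⟩
  · left
    have : (fun v => b v % 2) = ee i := funext hi
    rw [this, dg_ee] at hd
    rw [this] at h0
    exact ⟨i, _, by omega, h0⟩
  · right
    have : (fun v => b v % 2) = cc l := funext hl
    rw [this, dg_cc] at hd
    rw [this] at h0
    exact ⟨l, _, by omega, h0⟩

theorem star {g : Fin 4 → Fin 4 → (Fin 4 → ℕ) → Q} (hg : StarH g) :
    ∃ Th : Fin 4 → Fin 4 → Finset (Fin 4) → Q, ∀ j k b, dg b = 15 → g j k b = Th j k (sp b) := by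
  have hT : ∃ Th : Fin 4 → Fin 4 → Finset (Fin 4) → Q, (∀ j k i a, dg a = 7 →
      g j k (ee i + 2 • a) = Th j k (insert i (sp a))) := by
    choose T hT using fun j k => (hg.one j k).exT
    exact ⟨T, hT⟩
  obtain ⟨Th0, hTh0⟩ := hT
  obtain ⟨Th, hTh, hsym⟩ : ∃ Th : Fin 4 → Fin 4 → Finset (Fin 4) → Q, (∀ j k i a, dg a = 7 →
      g j k (ee i + 2 • a) = Th j k (insert i (sp a))) ∧ ∀ j k, Th j k = Th k j := by
    refine ⟨fun j k => if j < k then Th0 j k else Th0 k j, ?_, ?_⟩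
    · intro j k i a ha
      simp only
      split_ifs
      · exact hTh0 j k i a ha
      · rw [hg.symm j k]; exact hTh0 k j i a ha
    · intro j k
      rcases lt_trichotomy j k with h | h | h
      · simp [h, h.not_gt]
      · simp [h]
      · simp [h, h.not_gt]
  have T2 : ∀ j k l (V : Finset (Fin 4)), V.Nonempty →
      Th j k (insert l V) + Th j l (insert k V) + Th k l (insert j V) = 0 := by
    intro j k l V hV
    obtain ⟨v, hv, rfl⟩ := exists_v7 V hV
    have := hg.C2 j k l (2 • v) (by rw [dg_two, hv])
    rw [add_comm _ (ee l), add_comm _ (ee k), add_comm _ (ee j), hTh _ _ _ _ hv,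
      hTh _ _ _ _ hv, hTh _ _ _ _ hv] at this
    exact this
  let Hp : Fin 4 → Fin 4 → Fin 4 → (Fin 4 → ℕ) → Q := fun j k l u =>
    g j k (cc l + 2 • u) + Th j k ({l}ᶜ ∪ sp u)
  have hHp : ∀ j k l u, Hp j k l u = g j k (cc l + 2 • u) + Th j k ({l}ᶜ ∪ sp u) :=
    fun _ _ _ _ => rfl
  have Hsym : ∀ j k l u, Hp j k l u = Hp k j l u := by
    intro j k l u; rw [hHp, hHp, hg.symm j k, hsym j k]
  have cc3 : ∀ i u v l : Fin 4, i ≠ u → i ≠ v → u ≠ v → i ≠ l → u ≠ l → v ≠ l →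
      cc l = ee i + ee u + ee v ∧ ({l}ᶜ : Finset (Fin 4)) = {i, u, v} := by
    clear hTh hsym T2 Hp hHp Hsym
    intro i u v l h1 h2 h3 h4 h5 h6
    refine ⟨funext fun w => ?_, ?_⟩
    · revert i u v l w; decide
    · revert i u v l; decide
  -- vanishing for the index outside
  have Hm : ∀ j k m, j ≠ k → m ≠ j → m ≠ k → ∀ u, dg u = 6 → Hp j k m u = 0 := by
    intro j k m hjk hmj hmk u hu
    obtain ⟨l, hl⟩ : ∃ l : Fin 4, l ≠ j ∧ l ≠ k ∧ l ≠ m := by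
      clear * - j k m; revert j k m; decide
    obtain ⟨e1, e2⟩ := cc3 j k l m hjk hl.1.symm hl.2.1.symm hmj.symm hmk.symm hl.2.2
    have h := hg.C2 j k l (ee j + ee k + 2 • u)
      (by rw [dg_add, dg_add, dg_ee, dg_ee, dg_two, hu])
    have a1 : ee j + ee k + 2 • u + ee l = cc m + 2 • u := by rw [e1]; abel
    have a2 : ee j + ee k + 2 • u + ee k = ee j + 2 • (u + ee k) := by
      rw [smul_add, two_smul ℕ (ee k)]; abel
    have a3 : ee j + ee k + 2 • u + ee j = ee k + 2 • (u + ee j) := by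
      rw [smul_add, two_smul ℕ (ee j)]; abel
    rw [a1, a2, a3, hTh _ _ _ _ (by rw [dg_add, dg_ee, hu]),
      hTh _ _ _ _ (by rw [dg_add, dg_ee, hu]), sp_add_ee, sp_add_ee] at h
    have h2 := T2 j k l ({j, k} ∪ sp u) ⟨j, by simp⟩
    rw [hHp, e2]
    have b1 : insert l ({j, k} ∪ sp u) = {j, k, l} ∪ sp u := by ext w; simp; tauto
    have b2 : insert k ({j, k} ∪ sp u) = insert j (insert k (sp u)) := by ext w; simp
    have b3 : insert j ({j, k} ∪ sp u) = insert k (insert j (sp u)) := by ext w; simp; tauto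
    rw [b1, b2, b3] at h2
    rw [add_assoc] at h h2
    rw [eq_of_add2 h, eq_of_add2 h2, add_self2]
  have Hk : ∀ j k l, j ≠ k → j ≠ l → k ≠ l → ∀ u, dg u = 6 → Hp j k k u = Hp j l l u := by
    intro j k l hjk hjl hkl u hu
    obtain ⟨m, hm⟩ : ∃ m : Fin 4, m ≠ j ∧ m ≠ k ∧ m ≠ l := by
      clear * - j k l; revert j k l; decide
    obtain ⟨e1, e2⟩ := cc3 j m l k hm.1.symm hjl hm.2.2 hjk hm.2.1 hkl.symm
    obtain ⟨f1, f2⟩ := cc3 j m k l hm.1.symm hjk hm.2.1 hjl hm.2.2 hkl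
    have h := hg.C2 j k l (ee j + ee m + 2 • u)
      (by rw [dg_add, dg_add, dg_ee, dg_ee, dg_two, hu])
    have a1 : ee j + ee m + 2 • u + ee l = cc k + 2 • u := by rw [e1]; abel
    have a2 : ee j + ee m + 2 • u + ee k = cc l + 2 • u := by rw [f1]; abel
    have a3 : ee j + ee m + 2 • u + ee j = ee m + 2 • (u + ee j) := by
      rw [smul_add, two_smul ℕ (ee j)]; abel
    rw [a1, a2, a3, hTh _ _ _ _ (by rw [dg_add, dg_ee, hu]), sp_add_ee] at h
    have h2 := T2 j k l ({j, m} ∪ sp u) ⟨j, by simp⟩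
    have b1 : insert l ({j, m} ∪ sp u) = {j, m, l} ∪ sp u := by ext w; simp; tauto
    have b2 : insert k ({j, m} ∪ sp u) = {j, m, k} ∪ sp u := by ext w; simp; tauto
    have b3 : insert j ({j, m} ∪ sp u) = insert m (insert j (sp u)) := by ext w; simp; tauto
    rw [b1, b2, b3] at h2
    rw [hHp, hHp, e2, f2]
    apply eq_of_add2
    have h3 := congrArg₂ (· + ·) h h2
    simp only [add_zero] at h3
    have h4 := add_self2 (Th k l (insert m (insert j (sp u))))
    rw [← h3]
    generalize Th k l (insert m (insert j (sp u))) = x at h4 ⊢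
    rw [add_add_add_comm _ x, h4, add_zero]
    abel
  let nx : Fin 4 → Fin 4 := fun j => j + 1
  have hnx : ∀ j, nx j ≠ j := by decide
  let η : Fin 4 → (Fin 4 → ℕ) → Q := fun j u => Hp j (nx j) (nx j) u
  have hη : ∀ j k, j ≠ k → ∀ u, dg u = 6 → Hp j k k u = η j u := by
    intro j k hjk u hu
    by_cases h : k = nx j
    · rw [h]
    · exact Hk j k (nx j) hjk (hnx j).symm h u hu
  have hη' : ∀ j k, j ≠ k → ∀ u, dg u = 6 → Hp j k j u = η k u := by
    intro j k hjk u hu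
    rw [Hsym]; exact hη k j hjk.symm u hu
  have ER1 : ∀ i j u, dg u + 1 = 6 → η j (u + ee i) = η i (u + ee j) := by
    intro k j a ha
    by_cases hjk : j = k
    · subst hjk; rfl
    have h := (hg.one j k).R4 a (by omega)
    have h2 : ∑ l, Hp j k l (a + ee l) = 0 := by
      simp only [hHp, Finset.sum_add_distrib, h, zero_add]
      have : ∀ l : Fin 4, ({l}ᶜ ∪ sp (a + ee l) : Finset (Fin 4)) = Finset.univ := by
        intro l
        ext w
        simp [sp_add_ee]
        tauto
      simp only [this, Finset.sum_const, Finset.card_univ, Fintype.card_fin]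
      have h4 : ∀ x : Q, 4 • x = 0 := by
        intro x
        have : 4 • x = (x + x) + (x + x) := by abel
        rw [this, add_self2]
      exact h4 _
    rw [← Finset.sum_subset (Finset.subset_univ {j, k}), Finset.sum_pair hjk] at h2
    · rw [hη j k hjk _ (by rw [dg_add, dg_ee, ha]), hη' j k hjk _ (by rw [dg_add, dg_ee, ha])] at h2
      exact (eq_of_add2 h2).symm
    · intro l _ hl
      simp only [Finset.mem_insert, Finset.mem_singleton, not_or] at hl
      exact Hm j k l hjk hl.1 hl.2 _ (by rw [dg_add, dg_ee, ha])
  have ER2 : ∀ i a, dg a + 1 = 6 → ∑ v, ((a v : ℕ) : ZMod 2) • η i (a + ee v) = 0 := by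
    intro i a ha
    exact (hg.one i (nx i)).R3' (hTh i (nx i)) (nx i) a (by omega)
  obtain ⟨T, hT⟩ := KL 6 η ER1 ER2
  have E0 : ∀ i a, dg a = 6 → η i a = 0 := by
    intro i a ha
    obtain ⟨w, hw⟩ : ∃ w, 2 ≤ a w := by
      by_contra hcon
      push Not at hcon
      have : dg a ≤ ∑ v : Fin 4, 1 := Finset.sum_le_sum fun v _ => by
        have := hcon v; omega
      simp at this
      omega
    let u : Fin 4 → ℕ := fun v => if v = w then a w - 1 else a v
    have hu : a = u + ee w := by
      funext v
      simp only [u, ee, Pi.add_apply]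
      split_ifs with h
      · subst h; omega
      · omega
    have du : dg u = 5 := by rw [hu, dg_add, dg_ee] at ha; omega
    have h := ER2 i u (by omega)
    have h' : ∀ v, η i (u + ee v) = T (insert i (sp (u + ee v))) := by
      intro v; exact hT i _ (by rw [dg_add, dg_ee, du])
    simp only [h'] at h
    rw [sum_sp du (fun V => T (insert i V))] at h
    rw [hT i a ha]
    have : sp a = sp u := by
      ext v
      rw [mem_sp, mem_sp]
      simp only [u]
      split_ifs with h
      · subst h; omega
      · rfl
    rw [this]; exact h
  refine ⟨fun j k => if j = k then 0 else Th j k, ?_⟩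
  intro j k b hb
  by_cases hjk : j = k
  · subst hjk; simp [hg.diag]
  simp only [if_neg hjk]
  rcases vec_cases b hb with ⟨i, a, ha, rfl⟩ | ⟨l, a, ha, rfl⟩
  · rw [sp_two_ee]; exact hTh j k i a ha
  · rw [sp_two_cc]
    apply eq_of_add2
    change Hp j k l a = 0
    by_cases h1 : l = j
    · subst h1; rw [hη' _ _ hjk _ ha, E0 _ _ ha]
    · by_cases h2 : l = k
      · subst h2; rw [hη _ _ hjk _ ha, E0 _ _ ha]
      · exact Hm j k l hjk h1 h2 a ha

end star3

section upper

variable {Q : Type*} [AddCommGroup Q] [Module (ZMod 2) Q]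

/-- monomial with a given exponent function -/
def mE (b : Fin 4 → ℕ) : P 4 := monomial (Finsupp.equivFunOnFinite.symm b) 1

lemma mE_deg (b : Fin 4 → ℕ) : (Finsupp.equivFunOnFinite.symm b).degree = dg b := deg_fun b

lemma mE_add (a b : Fin 4 → ℕ) : mE (a + b) = mE a * mE b := by
  unfold mE
  rw [monomial_mul, one_mul]
  congr 2
  ext; simp

lemma mE_ee (v : Fin 4) : mE (ee v) = X v := by
  unfold mE X
  congr 2
  ext w
  simp [ee, Finsupp.single_apply, eq_comm]

lemma mE_two (a : Fin 4 → ℕ) : mE (2 • a) = mE a ^ 2 := by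
  rw [two_smul, mE_add, sq]

lemma mE_hom (a : Fin 4 → ℕ) : (mE a).IsHomogeneous (dg a) := by
  rw [← mE_deg]; exact homM _

lemma mE_of (a : Fin 4 →₀ ℕ) : (monomial a 1 : P 4) = mE a := by
  unfold mE; congr 2; ext; simp

lemma anti1 (F : (Fin 4 → ℕ) → Q) :
    ∑ k ∈ Finset.piAntidiag (Finset.univ : Finset (Fin 4)) 1, F k = ∑ v, F (ee v) := by
  have h : Finset.piAntidiag (Finset.univ : Finset (Fin 4)) 1 = Finset.univ.image ee := by
    decide +kernel
  rw [h, Finset.sum_image]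
  intro a _ b _ hab
  have := congrFun hab a
  by_contra hne
  simp [ee, hne] at this

lemma anti2 (F : (Fin 4 → ℕ) → Q) :
    ∑ k ∈ Finset.piAntidiag (Finset.univ : Finset (Fin 4)) 2, F k =
      ∑ v, F (2 • ee v) + ∑ u, ∑ v, if u < v then F (ee u + ee v) else 0 := by
  have h : Finset.piAntidiag (Finset.univ : Finset (Fin 4)) 2 =
      (Finset.univ.image fun v => 2 • ee v) ∪
      ((Finset.univ.filter (fun p : Fin 4 × Fin 4 => p.1 < p.2)).image
        fun p => ee p.1 + ee p.2) := by
    decide +kernel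
  have hd : Disjoint (Finset.univ.image fun v => 2 • ee v)
      ((Finset.univ.filter (fun p : Fin 4 × Fin 4 => p.1 < p.2)).image
        fun p => ee p.1 + ee p.2) := by decide +kernel
  rw [h, Finset.sum_union hd, Finset.sum_image, Finset.sum_image, Finset.sum_filter,
    ← Finset.univ_product_univ, Finset.sum_product]
  · have : ∀ p ∈ Finset.univ.filter (fun p : Fin 4 × Fin 4 => p.1 < p.2),
      ∀ q ∈ Finset.univ.filter (fun p : Fin 4 × Fin 4 => p.1 < p.2),
      ee p.1 + ee p.2 = ee q.1 + ee q.2 → p = q := by decide +kernel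
    exact fun p hp q hq => this p hp q hq
  · intro a _ b _ hab
    have := congrFun hab a
    by_contra hne
    simp [ee, hne] at this

lemma oneH_of {φ : P 4 →ₗ[ZMod 2] Q} (hφ : Hd 15 φ) : OneH (fun b => φ (mE b)) := by
  have hadd : ∀ b k : Fin 4 → ℕ, (monomial (Finsupp.equivFunOnFinite.symm b +
      Finsupp.equivFunOnFinite.symm k) 1 : P 4) = mE (b + k) := by
    intro b k; unfold mE; congr 2; ext; simp
  constructor
  · intro b hb
    have h := sqK hφ.1 (Finsupp.equivFunOnFinite.symm b) (e := 1) (by rw [mE_deg, hb])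
    rw [hφ.2 _ (by rw [mE_deg, hb]; norm_num), anti1] at h
    rw [h]
    refine Finset.sum_congr rfl fun v _ => ?_
    rw [hadd]
    congr 1
    fin_cases v <;> simp [Fin.prod_univ_four, ee]
  · intro b hb
    have h := sqK hφ.1 (Finsupp.equivFunOnFinite.symm b) (e := 2) (by rw [mE_deg, hb])
    rw [hφ.2 _ (by rw [mE_deg, hb]; norm_num), anti2] at h
    refine Eq.trans ?_ h.symm
    congr 1
    · refine Finset.sum_congr rfl fun v _ => ?_
      rw [hadd]
      congr 1
      fin_cases v <;> simp [Fin.prod_univ_four, ee]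
    · refine Finset.sum_congr rfl fun u _ => Finset.sum_congr rfl fun v _ => ?_
      split_ifs with huv
      · rw [hadd, add_assoc]
        congr 1
        fin_cases u <;> fin_cases v <;> first
          | (exfalso; revert huv; decide)
          | simp [Fin.prod_univ_four, ee]
      · rfl

lemma high_zero {n m : ℕ} {ψ : P n →ₗ[ZMod 2] Q} (hψ : SuppD m ψ) (a : Fin n →₀ ℕ)
    (h : m < a.degree) : ψ (SqT n (monomial a 1)) = 0 := by
  rw [sqT_mon, map_sum]
  refine Finset.sum_eq_zero fun k _ => ?_
  rw [map_smul, hψ, smul_zero]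
  rw [map_add]; omega

section phi
variable {φ : P 4 →ₗ[ZMod 2] Q} (hφ : Hd 67 φ)
include hφ

lemma peterson (i : Fin 4) (y : P 4) : φ (X i * y ^ 2) = 0 := by
  refine lin_zero (φ := pull (X i) φ) (fun a => ?_) y
  by_cases ha : a.degree = 33
  swap
  · exact pull_supp hφ.1 (hX i) (m := 33) (by norm_num) a ha
  rw [pull_apply]
  have hs : ∀ s, s < 6 → φ (X i ^ (2 ^ s) * SqT 4 (monomial a 1)) =
      φ (X i ^ (2 ^ (s + 1)) * SqT 4 (monomial a 1)) := by
    intro s hs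
    have h := hφ.hom (f := X i ^ (2 ^ s) * monomial a 1) (e := 1 * 2 ^ s + 33)
      (((hX i).pow _).mul (ha ▸ homM a)) (by interval_cases s <;> norm_num)
    rw [map_mul, map_pow, sqT_X, add_pow_char_pow, add_mul, map_add, ← pow_mul, ← pow_succ'] at h
    exact eq_of_add2 h
  have h6 : φ (X i ^ 64 * SqT 4 (monomial a 1)) = 0 :=
    high_zero (mul_supp hφ.1 ((hX i).pow 64) (m := 3) (by norm_num)) a (by omega)
  have h0 : φ (X i * SqT 4 (monomial a 1)) = φ (X i * monomial a 1 ^ 2) :=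
    topS (mul_supp hφ.1 (hX i) (m := 66) (by norm_num)) a (by omega)
  have e0 := hs 0 (by norm_num)
  have e1 := hs 1 (by norm_num)
  have e2 := hs 2 (by norm_num)
  have e3 := hs 3 (by norm_num)
  have e4 := hs 4 (by norm_num)
  have e5 := hs 5 (by norm_num)
  norm_num at e0 e1 e2 e3 e4 e5
  rw [← h0, e0, e1, e2, e3, e4, e5, h6]

lemma U2 (a b c : Fin 4) : Hd 32 (pull (X a * X b * X c) φ) := by
  refine ⟨pull_supp hφ.1 (((hX a).mul (hX b)).mul (hX c)) (by norm_num), ?_⟩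
  intro y hy
  have h := hφ.hom (f := X a * X b * X c * monomial y 1 ^ 2) (e := 1 + 1 + 1 + y.degree * 2)
    ((((hX a).mul (hX b)).mul (hX c)).mul ((homM y).pow 2)) (by omega)
  rw [pull_apply]
  simp only [map_mul, map_pow, sqT_X] at h
  generalize SqT 4 (monomial y 1) = z at h ⊢
  have e : (X a + X a ^ 2) * (X b + X b ^ 2) * (X c + X c ^ 2) * z ^ 2 =
      X a * X b * X c * z ^ 2 + X b * X c * (X a * z) ^ 2 + X a * X c * (X b * z) ^ 2
      + X a * X b * (X c * z) ^ 2 + X a * (X b * X c * z) ^ 2 + X b * (X a * X c * z) ^ 2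
      + X c * (X a * X b * z) ^ 2 + 1 * (X a * X b * X c * z) ^ 2 := by ring
  rw [e] at h
  simp only [map_add, peterson hφ] at h
  rw [pull_parity hφ.1 ((hX b).mul (hX c)) (by norm_num),
    pull_parity hφ.1 ((hX a).mul (hX c)) (by norm_num),
    pull_parity hφ.1 ((hX a).mul (hX b)) (by norm_num),
    pull_parity hφ.1 (isHomogeneous_one _ _) (by norm_num)] at h
  simpa using h

/-- product of the three variables different from `i` -/
def xS (i : Fin 4) : P 4 := X (i + 1) * X (i + 2) * X (i + 3)

omit hφ in
lemma mE_cc (i : Fin 4) : mE (cc i) = xS i := by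
  have : cc i = ee (i + 1) + ee (i + 2) + ee (i + 3) := by
    funext w; revert i w; decide
  rw [this, mE_add, mE_add, mE_ee, mE_ee, mE_ee]; rfl

set_option maxHeartbeats 1000000 in
lemma sumrel (y : Fin 4 →₀ ℕ) (hy : y.degree = 31) :
    ∑ i, pull (xS i) φ (X i * monomial y 1) = 0 := by
  have h := hφ.hom (f := X 0 * X 1 * X 2 * X 3 * monomial y 1 ^ 2)
    (e := 1 + 1 + 1 + 1 + y.degree * 2)
    (((((hX 0).mul (hX 1)).mul (hX 2)).mul (hX 3)).mul ((homM y).pow 2)) (by omega)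
  have hl : ∀ i, pull (xS i) φ (X i * monomial y 1) =
      φ (xS i * (X i * SqT 4 (monomial y 1)) ^ 2) := by
    intro i
    have hS : Hd 32 (pull (xS i) φ) := U2 hφ (i + 1) (i + 2) (i + 3)
    have := low0 (mul_supp hS.1 (hX i) (m := 31) (by norm_num)) y hy
    rw [LinearMap.comp_apply, LinearMap.comp_apply, LinearMap.mulLeft_apply,
      LinearMap.mulLeft_apply, pull_apply (xS i) φ (X i * SqT 4 _)] at this
    exact this.symm
  simp_rw [hl]
  simp only [map_mul, map_pow, sqT_X] at h
  generalize SqT 4 (monomial y 1) = z at h ⊢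
  have e : (X 0 + X 0 ^ 2) * (X 1 + X 1 ^ 2) * (X 2 + X 2 ^ 2) * (X 3 + X 3 ^ 2) * z ^ 2 =
      X 0 * X 1 * X 2 * X 3 * z ^ 2
      + (X 1 * X 2 * X 3 * (X 0 * z) ^ 2 + X 2 * X 3 * X 0 * (X 1 * z) ^ 2
      + X 3 * X 0 * X 1 * (X 2 * z) ^ 2 + X 0 * X 1 * X 2 * (X 3 * z) ^ 2)
      + X 0 * X 1 * (X 2 * X 3 * z) ^ 2 + X 0 * X 2 * (X 1 * X 3 * z) ^ 2
      + X 0 * X 3 * (X 1 * X 2 * z) ^ 2 + X 1 * X 2 * (X 0 * X 3 * z) ^ 2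
      + X 1 * X 3 * (X 0 * X 2 * z) ^ 2 + X 2 * X 3 * (X 0 * X 1 * z) ^ 2
      + X 0 * (X 1 * X 2 * X 3 * z) ^ 2 + X 1 * (X 0 * X 2 * X 3 * z) ^ 2
      + X 2 * (X 0 * X 1 * X 3 * z) ^ 2 + X 3 * (X 0 * X 1 * X 2 * z) ^ 2
      + 1 * (X 0 * X 1 * X 2 * X 3 * z) ^ 2 := by ring
  rw [e] at h
  simp only [map_add, peterson hφ] at h
  have p2 : ∀ (i j : Fin 4) w, φ (X i * X j * w ^ 2) = 0 := fun i j w =>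
    pull_parity hφ.1 ((hX i).mul (hX j)) (by norm_num) w
  rw [pull_parity hφ.1 (isHomogeneous_one _ _) (by norm_num),
    pull_parity hφ.1 ((((hX 0).mul (hX 1)).mul (hX 2)).mul (hX 3)) (by norm_num)] at h
  simp only [p2, add_zero, zero_add] at h
  rw [Fin.sum_univ_four]
  exact h

end phi

section Phi32
variable {Φ : P 4 →ₗ[ZMod 2] Q} (hΦ : Hd 32 Φ)
include hΦ

lemma sq0 (z : P 4) : Φ (z ^ 2) = 0 := by
  have := lin_zero (φ := pull 1 Φ) (fun a => ?_) z
  · simpa [pull_apply] using this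
  by_cases ha : a.degree = 16
  · rw [pull_apply, one_mul, ← topS hΦ.1 a (by omega)]
    exact hΦ.2 a (by omega)
  · exact pull_supp hΦ.1 (isHomogeneous_one _ _) (m := 16) (by norm_num) a ha

lemma f15 (j k : Fin 4) : Hd 15 (pull (X j * X k) Φ) := by
  refine ⟨pull_supp hΦ.1 ((hX j).mul (hX k)) (by norm_num), ?_⟩
  intro y hy
  have h := hΦ.hom (f := X j * X k * monomial y 1 ^ 2) (e := 1 + 1 + y.degree * 2)
    (((hX j).mul (hX k)).mul ((homM y).pow 2)) (by omega)
  rw [pull_apply]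
  simp only [map_mul, map_pow, sqT_X] at h
  generalize SqT 4 (monomial y 1) = z at h ⊢
  have e : (X j + X j ^ 2) * (X k + X k ^ 2) * z ^ 2 = X j * X k * z ^ 2 + X j * (X k * z) ^ 2
    + X k * (X j * z) ^ 2 + (X j * X k * z) ^ 2 := by ring
  have p1 : ∀ (i : Fin 4) w, Φ (X i * w ^ 2) = 0 := fun i w =>
    pull_parity hΦ.1 (hX i) (by norm_num) w
  rw [e] at h
  simpa only [map_add, sq0 hΦ, p1, add_zero] using h

lemma fC2 (j k l : Fin 4) (y : Fin 4 →₀ ℕ) (hy : y.degree = 14) :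
    pull (X j * X k) Φ (X l * monomial y 1) + pull (X j * X l) Φ (X k * monomial y 1)
      + pull (X k * X l) Φ (X j * monomial y 1) = 0 := by
  have h := hΦ.hom (f := X j * X k * X l * monomial y 1 ^ 2) (e := 1 + 1 + 1 + y.degree * 2)
    ((((hX j).mul (hX k)).mul (hX l)).mul ((homM y).pow 2)) (by omega)
  have hl : ∀ i j k, pull (X j * X k) Φ (X i * monomial y 1) =
      Φ (X j * X k * (X i * SqT 4 (monomial y 1)) ^ 2) := by
    intro i j k
    exact (low0 (mul_supp (f15 hΦ j k).1 (hX i) (m := 14) (by norm_num)) y hy).symm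
  rw [hl, hl, hl]
  simp only [map_mul, map_pow, sqT_X] at h
  generalize SqT 4 (monomial y 1) = z at h ⊢
  have e : (X j + X j ^ 2) * (X k + X k ^ 2) * (X l + X l ^ 2) * z ^ 2 =
      X j * X k * X l * z ^ 2 + (X j * X k * (X l * z) ^ 2 + X j * X l * (X k * z) ^ 2
      + X k * X l * (X j * z) ^ 2) + X j * (X k * X l * z) ^ 2 + X k * (X j * X l * z) ^ 2
      + X l * (X j * X k * z) ^ 2 + (X j * X k * X l * z) ^ 2 := by ring
  have p1 : ∀ (i : Fin 4) w, Φ (X i * w ^ 2) = 0 := fun i w =>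
    pull_parity hΦ.1 (hX i) (by norm_num) w
  rw [e] at h
  simp only [map_add, sq0 hΦ, p1, add_zero] at h
  rw [pull_parity hΦ.1 (((hX j).mul (hX k)).mul (hX l)) (by norm_num), zero_add] at h
  exact h

lemma starH_of : StarH (fun j k b => pull (X j * X k) Φ (mE b)) where
  one j k := oneH_of (f15 hΦ j k)
  symm j k := by simp only [mul_comm (X j : P 4)]
  diag j b := by
    rw [pull_apply, ← sq, ← mul_pow]; exact sq0 hΦ _
  C2 j k l y hy := by
    have := fC2 hΦ j k l (Finsupp.equivFunOnFinite.symm y) (by rw [mE_deg, hy])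
    simp only [mE_add, mE_ee, mul_comm (mE y)]
    exact this

end Phi32

end upper

section upper2

variable {Q : Type*} [AddCommGroup Q] [Module (ZMod 2) Q]

def i0 (t : Fin 4) : Fin 4 := if t = 3 then 2 else 3

/-- valid indices of the basis in four variables -/
def val4 (t : Fin 4) (U : Finset (Fin 4)) (i k : Fin 4) : Prop :=
  t ∈ U ∧ (∀ s ∈ U, t ≤ s) ∧ i ≠ t ∧ k ≠ t ∧ ¬ (i = k ∧ i = i0 t)

instance (t : Fin 4) (U : Finset (Fin 4)) (i k : Fin 4) : Decidable (val4 t U i k) := by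
  unfold val4; infer_instance

def rep (t : Fin 4) (U : Finset (Fin 4)) : Fin 4 → ℕ := fun w =>
  if w = t then 16 - U.card else if w ∈ U then 1 else 0

def e4 (t : Fin 4) (U : Finset (Fin 4)) (i k : Fin 4) : Fin 4 → ℕ :=
  cc i + 2 • (ee t + ee k + 2 • rep t U)

lemma rep_dg (t : Fin 4) (U : Finset (Fin 4)) (h : t ∈ U) : dg (rep t U) = 15 := by
  revert t U; decide +kernel

lemma rep_sp (t : Fin 4) (U : Finset (Fin 4)) (h : t ∈ U) : sp (rep t U) = U := by
  revert t U; decide +kernel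

lemma tri (F : Fin 4 → Fin 4 → Fin 4 → Finset (Fin 4) → Q)
    (sym : ∀ i j k U, F i j k U = F i k j U)
    (dia : ∀ i j (U : Finset (Fin 4)), U.Nonempty → F i j j U = 0)
    (C2 : ∀ i j k l (V : Finset (Fin 4)), V.Nonempty →
      F i j k (insert l V) + F i j l (insert k V) + F i k l (insert j V) = 0)
    (C1 : ∀ a (U : Finset (Fin 4)), U.Nonempty → ∑ i, F i i a U = 0)
    (B : ∀ t U i k, val4 t U i k → F i t k U = 0) :
    ∀ m (U : Finset (Fin 4)), U.card + m = 4 → U.Nonempty → ∀ i j k, F i j k U = 0 := by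
  intro m
  induction m using Nat.strong_induction_on with
  | _ m ih =>
  intro U hUm hU
  have IH : ∀ l, l ∉ U → ∀ i j k, F i j k (insert l U) = 0 := by
    intro l hl
    have hc := Finset.card_insert_of_notMem hl
    have : (insert l U).card ≤ 4 := by simpa using Finset.card_le_univ (insert l U)
    exact ih (m - 1) (by omega) _ (by omega) (Finset.insert_nonempty _ _)
  obtain ⟨t, htU, htm⟩ : ∃ t ∈ U, ∀ s ∈ U, t ≤ s :=
    ⟨U.min' hU, U.min'_mem hU, fun s hs => U.min'_le s hs⟩
  have L : ∀ i, (∀ k, F i t k U = 0) → ∀ k l, F i k l U = 0 := by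
    intro i hi k l
    have h := C2 i t k l U hU
    have h1 : ∀ k l, F i t k (insert l U) = 0 := by
      intro k l
      by_cases hl : l ∈ U
      · rw [Finset.insert_eq_of_mem hl]; exact hi k
      · exact IH l hl _ _ _
    rw [h1, h1, Finset.insert_eq_of_mem htU] at h
    simpa using h
  have hi0 : i0 t ≠ t := by clear * -; revert t; decide
  have n1 : ∀ i, i ≠ t → i ≠ i0 t → ∀ k l, F i k l U = 0 := by
    intro i hit hi
    apply L
    intro k
    by_cases hk : k = t
    · subst hk; exact dia _ _ _ hU
    · exact B t U i k ⟨htU, htm, hit, hk, fun h => hi h.2⟩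
  have n2 : ∀ k l, F (i0 t) k l U = 0 := by
    apply L
    intro k
    by_cases hk : k = t
    · subst hk; exact dia _ _ _ hU
    · by_cases hk2 : k = i0 t
      · have h := C1 t U hU
        rw [Finset.sum_eq_single (i0 t)] at h
        · rw [hk2, sym]; exact h
        · intro i _ hi
          by_cases hit : i = t
          · subst hit; exact dia _ _ _ hU
          · exact n1 i hit hi _ _
        · simp
      · exact B t U _ k ⟨htU, htm, hi0, hk, fun h => hk2 h.1.symm⟩
  have n3 : ∀ i, i ≠ t → ∀ k l, F i k l U = 0 := by
    intro i hi
    by_cases h : i = i0 t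
    · rw [h]; exact n2
    · exact n1 i hi h
  intro i
  by_cases hi : i = t
  · subst hi
    apply L
    intro k
    have h := C1 k U hU
    rw [Finset.sum_eq_single i] at h
    · exact h
    · intro j _ hj; exact n3 j hj _ _
    · simp
  · exact n3 i hi

lemma mE_e4 (φ : P 4 →ₗ[ZMod 2] Q) (t : Fin 4) (U : Finset (Fin 4)) (i k : Fin 4) :
    φ (mE (e4 t U i k)) = pull (X t * X k) (pull (xS i) φ) (mE (rep t U)) := by
  unfold e4
  rw [mE_add, mE_cc, mE_two, mE_add, mE_add, mE_ee, mE_ee, mE_two]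
  rfl

lemma exists_c14 (V : Finset (Fin 4)) (hV : V.Nonempty) : ∃ v, dg v = 14 ∧ sp v = V := by
  have : ∀ V : Finset (Fin 4), V.Nonempty → ∃ t ∈ V,
      ∑ w, (if w = t then 15 - V.card else if w ∈ V then 1 else 0) = 14 ∧ V.card < 8 := by decide
  obtain ⟨t, ht, h, hc⟩ := this V hV
  refine ⟨fun w => if w = t then 15 - V.card else if w ∈ V then 1 else 0, h, ?_⟩
  ext w
  rw [mem_sp]
  split_ifs with h1 h2
  · subst h1; simp [ht]; omega
  · simp [h2]
  · simp [h2]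

lemma bits (b : Fin 4 → ℕ) : ∃ (s : Fin 4 → Fin 2) (a : Fin 4 → ℕ),
    b = (fun v => (s v : ℕ)) + 2 • a := by
  refine ⟨fun v => ⟨b v % 2, Nat.mod_lt _ (by norm_num)⟩, fun v => b v / 2, ?_⟩
  funext v; simp; omega

lemma zero15 {f : P 4 →ₗ[ZMod 2] Q} {d : ℕ} (hf : SuppD d f)
    (h : ∀ b, dg b = d → f (mE b) = 0) (y : P 4) : f y = 0 := by
  refine lin_zero (fun a => ?_) y
  by_cases ha : a.degree = d
  · rw [mE_of]
    apply h
    rw [← ha, Finsupp.degree_eq_sum]; rfl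
  · exact hf a ha

theorem upper4 {φ : P 4 →ₗ[ZMod 2] Q} (hφ : Hd 67 φ)
    (hB : ∀ t U i k, val4 t U i k → φ (mE (e4 t U i k)) = 0) (y : P 4) : φ y = 0 := by
  have hΦ : ∀ i, Hd 32 (pull (xS i) φ) := fun i => U2 hφ (i + 1) (i + 2) (i + 3)
  choose Th hTh using fun i => star (starH_of (hΦ i))
  have hrel : ∀ y, dg y = 31 → ∑ i, pull (xS i) φ (X i * mE y) = 0 := fun y hy =>
    sumrel hφ _ (by rw [mE_deg, hy])
  -- symmetric and normalized version
  let F : Fin 4 → Fin 4 → Fin 4 → Finset (Fin 4) → Q := fun i j k U =>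
    if h : U.Nonempty then pull (X j * X k) (pull (xS i) φ) (mE (exists_c15 U h).choose) else 0
  have hF : ∀ i j k b, dg b = 15 → F i j k (sp b) = pull (X j * X k) (pull (xS i) φ) (mE b) := by
    intro i j k b hb
    have hne : (sp b).Nonempty := by
      by_contra hcon
      rw [Finset.not_nonempty_iff_eq_empty] at hcon
      have : dg b = 0 := Finset.sum_eq_zero fun v _ => by
        by_contra h0
        have : v ∈ sp b := mem_sp.2 (by omega)
        rw [hcon] at this; simp at this
      omega
    simp only [F, dif_pos hne]
    have h := (exists_c15 (sp b) hne).choose_spec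
    rw [hTh i j k _ hb, hTh i j k _ h.1, h.2]
  have hF0 : ∀ (U : Finset (Fin 4)), U.Nonempty → ∀ i j k, F i j k U = 0 := by
    intro U hU
    refine tri F ?_ ?_ ?_ ?_ ?_ (4 - U.card) U ?_ hU
    · intro i j k U; simp only [F, mul_comm (X j : P 4)]
    · intro i j U hU
      obtain ⟨b, hb, rfl⟩ := exists_c15 U hU
      rw [hF _ _ _ _ hb]
      exact (starH_of (hΦ i)).diag j b
    · intro i j k l V hV
      obtain ⟨v, hv, rfl⟩ := exists_c14 V hV
      rw [← sp_add_ee, ← sp_add_ee, ← sp_add_ee, hF _ _ _ _ (by rw [dg_add, dg_ee, hv]),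
        hF _ _ _ _ (by rw [dg_add, dg_ee, hv]), hF _ _ _ _ (by rw [dg_add, dg_ee, hv])]
      exact (starH_of (hΦ i)).C2 j k l v hv
    · intro a U hU
      obtain ⟨b, hb, rfl⟩ := exists_c15 U hU
      have h := hrel (ee a + 2 • b) (by rw [dg_add, dg_two, dg_ee, hb])
      rw [← h]
      refine Finset.sum_congr rfl fun i _ => ?_
      rw [hF _ _ _ _ hb, mE_add, mE_two, mE_ee, ← mul_assoc]
      rfl
    · intro t U i k hv
      have h := hB t U i k hv
      rw [mE_e4] at h
      rw [← rep_sp t U hv.1, hF _ _ _ _ (rep_dg t U hv.1), h]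
    · have : U.card ≤ 4 := by simpa using Finset.card_le_univ U
      omega
  have hf : ∀ i j k y, pull (X j * X k) (pull (xS i) φ) y = 0 := by
    intro i j k y
    refine zero15 (f15 (hΦ i) j k).1 (fun b hb => ?_) y
    rw [← hF _ _ _ _ hb]
    by_cases hU : (sp b).Nonempty
    · exact hF0 _ hU _ _ _
    · simp only [F, dif_neg hU]
  have hΦ0 : ∀ i y, pull (xS i) φ y = 0 := by
    intro i y
    refine zero15 (hΦ i).1 (fun b hb => ?_) y
    obtain ⟨s, a, rfl⟩ := bits b
    have key : ∀ s : Fin 4 → Fin 2, (∑ v, (s v : ℕ)) % 2 ≠ 32 % 2 ∨ (∀ v, (s v : ℕ) = 0) ∨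
      (∃ j k, ∀ v, (s v : ℕ) = ee j v + ee k v) ∨ (∀ v, (s v : ℕ) = 1) := by decide
    rw [mE_add, mE_two]
    rcases key s with h | h | ⟨j, k, h⟩ | h
    · exact pull_parity (hΦ i).1 (mE_hom _) h _
    · have : (fun v => (s v : ℕ)) = 0 := funext h
      have h0 : Finsupp.equivFunOnFinite.symm (0 : Fin 4 → ℕ) = 0 := by ext; simp
      have h1 : mE 0 = 1 := by unfold mE; rw [h0, ← C_apply, map_one]
      rw [this, h1, one_mul]
      exact sq0 (hΦ i) _
    · have : (fun v => (s v : ℕ)) = ee j + ee k := funext h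
      rw [this, mE_add, mE_ee, mE_ee]
      exact hf i j k _
    · have h1 : (fun v => (s v : ℕ)) = ee i + cc i := by
        funext v; rw [h v]; clear * - v; revert v i; decide
      rw [h1, mE_add, mE_cc, mE_ee]
      have hd : dg a = 14 := by
        rw [h1, dg_add, dg_add, dg_ee, dg_cc, dg_two] at hb; omega
      have h := hrel (cc i + 2 • a) (by rw [dg_add, dg_two, dg_cc, hd])
      rw [Finset.sum_eq_single i] at h
      · rw [mE_add, mE_cc, mE_two] at h
        rw [mul_assoc]; exact h
      · intro j _ hj
        obtain ⟨k, l, hc⟩ : ∃ k l, cc i = ee j + ee k + ee l := by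
          have : ∀ i j : Fin 4, j ≠ i → ∃ k l, ∀ v, cc i v = ee j v + ee k v + ee l v := by decide
          obtain ⟨k, l, h⟩ := this i j hj
          exact ⟨k, l, funext h⟩
        have : X j * mE (cc i + 2 • a) = X k * X l * (X j * mE a) ^ 2 := by
          rw [hc, mE_add, mE_add, mE_add, mE_two, mE_ee, mE_ee, mE_ee]; ring
        rw [this]
        exact hf j k l _
      · simp
  refine zero15 hφ.1 (fun b hb => ?_) y
  obtain ⟨s, a, rfl⟩ := bits b
  have key : ∀ s : Fin 4 → Fin 2, (∑ v, (s v : ℕ)) % 2 ≠ 67 % 2 ∨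
      (∃ j, ∀ v, (s v : ℕ) = ee j v) ∨ (∃ j, ∀ v, (s v : ℕ) = cc j v) := by decide
  rw [mE_add, mE_two]
  rcases key s with h | ⟨j, h⟩ | ⟨j, h⟩
  · exact pull_parity hφ.1 (mE_hom _) h _
  · have : (fun v => (s v : ℕ)) = ee j := funext h
    rw [this, mE_ee]
    exact peterson hφ j _
  · have : (fun v => (s v : ℕ)) = cc j := funext h
    rw [this, mE_cc]
    exact hΦ0 j _

end upper2

section lower

variable {Q : Type*} [AddCommGroup Q] [Module (ZMod 2) Q]

/-- substitutions by linear forms -/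
lemma Hd.comp {m n d : ℕ} {φ : P n →ₗ[ZMod 2] Q} (hφ : Hd d φ) (l : Fin m → P n)
    (h1 : ∀ i, (l i).IsHomogeneous 1) (h2 : ∀ i, SqT n (l i) = l i + l i ^ 2) :
    Hd d (φ ∘ₗ (aeval l : P m →ₐ[ZMod 2] P n).toLinearMap) := by
  have hh : ∀ a : Fin m →₀ ℕ, (aeval l (monomial a (1 : ZMod 2)) : P n).IsHomogeneous a.degree := by
    intro a
    simpa using (homM a).aeval l h1
  have hc : ∀ f : P m, SqT n (aeval l f) = aeval l (SqT m f) := by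
    intro f
    have : (SqT n).comp (aeval l) = (aeval l : P m →ₐ[ZMod 2] P n).comp (SqT m) := by
      ext1 i
      simp [h2, sqT_X]
    exact DFunLike.congr_fun this f
  constructor
  · intro a ha
    exact hφ.1.hom (hh a) ha
  · intro a ha
    have := hφ.hom (hh a) ha
    rw [hc] at this
    exact this

lemma SuppD.comp_hom {n d : ℕ} {φ : P n →ₗ[ZMod 2] Q} (hφ : SuppD d φ) (f : P n) :
    φ (homogeneousComponent d f) = φ f := by
  have h := sum_homogeneousComponent f
  conv_rhs => rw [← h]
  rw [map_sum]
  by_cases hd : d < f.totalDegree + 1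
  · rw [Finset.sum_eq_single d]
    · intro e _ he
      exact hφ.hom (homogeneousComponent_isHomogeneous e f) he
    · intro h; exact absurd (Finset.mem_range.2 hd) h
  · rw [homogeneousComponent_eq_zero _ _ (by omega), map_zero, Finset.sum_eq_zero]
    intro e he
    have := Finset.mem_range.1 he
    exact hφ.hom (homogeneousComponent_isHomogeneous e f) (by omega)

lemma Hd.hit {n d : ℕ} {φ : P n →ₗ[ZMod 2] Q} (hφ : Hd d φ) {u : P n} (hu : u ∈ hitSub n d) :
    φ u = 0 := by
  have : hitSub n d ≤ LinearMap.ker φ := by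
    unfold hitSub
    rw [Submodule.span_le]
    rintro u ⟨f, hf, rfl⟩
    rw [SetLike.mem_coe, LinearMap.mem_ker, map_sum]
    refine Finset.sum_eq_zero fun i hi => ?_
    have hi := Finset.mem_Icc.1 hi
    rw [hφ.1.comp_hom]
    exact hφ.hom ((mem_homogeneousSubmodule _ _).1 (hf i)) (by omega)
  exact this hu

/-- exponent in three variables -/
def s3 (a b c : ℕ) : Fin 3 →₀ ℕ := Finsupp.equivFunOnFinite.symm ![a, b, c]

def T3 : P 3 →ₗ[ZMod 2] ZMod 2 := lcoeff (ZMod 2) (s3 63 3 1)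

lemma T3_apply (f : P 3) : T3 f = coeff (s3 63 3 1) f := rfl

lemma s3_deg (a b c : ℕ) : (s3 a b c).degree = a + b + c := by
  unfold s3; rw [deg_fun]; simp [Fin.sum_univ_three]

lemma T3_Hd : Hd 67 T3 := by
  constructor
  · intro a ha
    rw [T3_apply, coeff_monomial, if_neg]
    rintro rfl
    exact ha (s3_deg _ _ _)
  · intro a ha
    rw [sqT_mon, map_sum]
    refine Finset.sum_eq_zero fun k _ => ?_
    rw [map_smul, T3_apply, coeff_monomial]
    split_ifs with h
    swap
    · simp
    have h0 := DFunLike.congr_fun h 0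
    have h1 := DFunLike.congr_fun h 1
    have h2 := DFunLike.congr_fun h 2
    simp [s3] at h0 h1 h2
    rw [Finsupp.degree_eq_sum, Fin.sum_univ_three] at ha
    have d63 : ∀ k ∈ Finset.range 64, 0 < k → (((63 - k).choose k : ℕ) : ZMod 2) = 0 := by
      decide +kernel
    have d3 : ∀ k ∈ Finset.range 4, 0 < k → (((3 - k).choose k : ℕ) : ZMod 2) = 0 := by
      decide +kernel
    have d1 : ∀ k ∈ Finset.range 2, 0 < k → (((1 - k).choose k : ℕ) : ZMod 2) = 0 := by
      decide +kernel
    rw [Fin.prod_univ_three]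
    have : 0 < k 0 ∨ 0 < k 1 ∨ 0 < k 2 := by omega
    rcases this with hk | hk | hk
    · have := d63 (k 0) (Finset.mem_range.2 (by omega)) hk
      rw [show 63 - k 0 = a 0 by omega] at this
      simp [this]
    · have := d3 (k 1) (Finset.mem_range.2 (by omega)) hk
      rw [show 3 - k 1 = a 1 by omega] at this
      simp [this]
    · have := d1 (k 2) (Finset.mem_range.2 (by omega)) hk
      rw [show 1 - k 2 = a 2 by omega] at this
      simp [this]

lemma codd (s m : Fin 3 →₀ ℕ) (i : Fin 3) (hi : (s i + m i) % 2 = 1) (h : P 3) :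
    coeff s (monomial m 1 * h ^ 2) = 0 := by
  rw [coeff_monomial_mul']
  split_ifs with hle
  · rw [← expand_zmod, coeff_expand_of_not_dvd (i := i), mul_zero]
    have := hle i
    rw [Finsupp.coe_tsub, Pi.sub_apply]
    omega
  · rfl

lemma ceven (m u : Fin 3 →₀ ℕ) (h : P 3) :
    coeff (2 • u + m) (monomial m 1 * h ^ 2) = coeff u h := by
  rw [add_comm, coeff_monomial_mul, one_mul, ← expand_zmod, coeff_expand_smul 2 (by norm_num)]

lemma M3 (a b c : ℕ) : (monomial (s3 a b c) 1 : P 3) = X 0 ^ a * X 1 ^ b * X 2 ^ c := by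
  rw [mon_eq, Fin.prod_univ_three]; simp [s3]

/-- linear form -/
def lf (p q r : ZMod 2) : P 3 := C p * X 0 + C q * X 1 + C r * X 2

lemma lf_hom (p q r : ZMod 2) : (lf p q r).IsHomogeneous 1 :=
  ((isHomogeneous_C_mul_X p 0).add (isHomogeneous_C_mul_X q 1)).add (isHomogeneous_C_mul_X r 2)

lemma SqT_C {n : ℕ} (p : ZMod 2) : SqT n (C p) = C p := by
  rw [← algebraMap_eq]; exact AlgHom.commutes _ _

lemma lf_sq (p q r : ZMod 2) : SqT 3 (lf p q r) = lf p q r + lf p q r ^ 2 := by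
  have hC : ∀ p : ZMod 2, (C p : P 3) ^ 2 = C p := by
    intro p; rw [← map_pow]; congr 1; exact ZMod.pow_card p
  unfold lf
  rw [map_add, map_add, map_mul, map_mul, map_mul, sqT_X, sqT_X, sqT_X, SqT_C, SqT_C, SqT_C,
    CharTwo.add_sq, CharTwo.add_sq, mul_pow, mul_pow, mul_pow, hC, hC, hC]
  ring

lemma T3_C (c : ZMod 2) (f : P 3) (s : Fin 3 →₀ ℕ) : coeff s (C c * f) = c * coeff s f :=
  coeff_C_mul _ _ _

lemma ev3 (p q r p' q' r' p'' q'' r'' : ZMod 2) (h : P 3) :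
    coeff (s3 63 3 1) (lf p q r * lf p' q' r' * lf p'' q'' r'' * h ^ 2) =
    (p * q' * r'' + p * r' * q'' + q * p' * r'' + q * r' * p'' + r * p' * q'' + r * q' * p'') *
      coeff (s3 31 1 0) h := by
  have e : lf p q r * lf p' q' r' * lf p'' q'' r'' * h ^ 2 =
      C (p * q' * r'' + p * r' * q'' + q * p' * r'' + q * r' * p'' + r * p' * q'' + r * q' * p'') *
        (X 0 ^ 1 * X 1 ^ 1 * X 2 ^ 1 * h ^ 2)
      + C (p * p' * p'') * (X 0 ^ 1 * X 1 ^ 0 * X 2 ^ 0 * (X 0 * h) ^ 2)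
      + C (p * q' * q'' + q * p' * q'' + q * q' * p'') *
        (X 0 ^ 1 * X 1 ^ 0 * X 2 ^ 0 * (X 1 * h) ^ 2)
      + C (p * r' * r'' + r * p' * r'' + r * r' * p'') *
        (X 0 ^ 1 * X 1 ^ 0 * X 2 ^ 0 * (X 2 * h) ^ 2)
      + C (q * q' * q'') * (X 0 ^ 0 * X 1 ^ 1 * X 2 ^ 0 * (X 1 * h) ^ 2)
      + C (q * p' * p'' + p * q' * p'' + p * p' * q'') *
        (X 0 ^ 0 * X 1 ^ 1 * X 2 ^ 0 * (X 0 * h) ^ 2)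
      + C (q * r' * r'' + r * q' * r'' + r * r' * q'') *
        (X 0 ^ 0 * X 1 ^ 1 * X 2 ^ 0 * (X 2 * h) ^ 2)
      + C (r * r' * r'') * (X 0 ^ 0 * X 1 ^ 0 * X 2 ^ 1 * (X 2 * h) ^ 2)
      + C (r * p' * p'' + p * r' * p'' + p * p' * r'') *
        (X 0 ^ 0 * X 1 ^ 0 * X 2 ^ 1 * (X 0 * h) ^ 2)
      + C (r * q' * q'' + q * r' * q'' + q * q' * r'') *
        (X 0 ^ 0 * X 1 ^ 0 * X 2 ^ 1 * (X 1 * h) ^ 2) := by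
    unfold lf
    simp only [map_add, map_mul]
    ring
  rw [e]
  simp only [← M3, coeff_add, coeff_C_mul]
  have z0 : ∀ h : P 3, coeff (s3 63 3 1) (monomial (s3 1 0 0) 1 * h ^ 2) = 0 :=
    codd _ _ 1 (by simp [s3])
  have z1 : ∀ h : P 3, coeff (s3 63 3 1) (monomial (s3 0 1 0) 1 * h ^ 2) = 0 :=
    codd _ _ 0 (by simp [s3])
  have z2 : ∀ h : P 3, coeff (s3 63 3 1) (monomial (s3 0 0 1) 1 * h ^ 2) = 0 :=
    codd _ _ 0 (by simp [s3])
  have hs : s3 63 3 1 = 2 • s3 31 1 0 + s3 1 1 1 := by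
    ext i; fin_cases i <;> simp [s3]
  simp only [z0, z1, z2, mul_zero, add_zero]
  rw [hs, ceven]

lemma ev2 (p q r p' q' r' : ZMod 2) (h : P 3) :
    coeff (s3 31 1 0) (lf p q r * lf p' q' r' * h ^ 2) =
    (p * q' + q * p') * coeff (s3 15 0 0) h := by
  have e : lf p q r * lf p' q' r' * h ^ 2 =
      C (p * q' + q * p') * (X 0 ^ 1 * X 1 ^ 1 * X 2 ^ 0 * h ^ 2)
      + C (p * r' + r * p') * (X 0 ^ 1 * X 1 ^ 0 * X 2 ^ 1 * h ^ 2)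
      + C (q * r' + r * q') * (X 0 ^ 0 * X 1 ^ 1 * X 2 ^ 1 * h ^ 2)
      + C (p * p') * (X 0 ^ 0 * X 1 ^ 0 * X 2 ^ 0 * (X 0 * h) ^ 2)
      + C (q * q') * (X 0 ^ 0 * X 1 ^ 0 * X 2 ^ 0 * (X 1 * h) ^ 2)
      + C (r * r') * (X 0 ^ 0 * X 1 ^ 0 * X 2 ^ 0 * (X 2 * h) ^ 2) := by
    unfold lf
    simp only [map_add, map_mul]
    ring
  rw [e]
  simp only [← M3, coeff_add, coeff_C_mul]
  have z0 : ∀ h : P 3, coeff (s3 31 1 0) (monomial (s3 1 0 1) 1 * h ^ 2) = 0 :=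
    codd _ _ 1 (by simp [s3])
  have z1 : ∀ h : P 3, coeff (s3 31 1 0) (monomial (s3 0 1 1) 1 * h ^ 2) = 0 :=
    codd _ _ 0 (by simp [s3])
  have z2 : ∀ h : P 3, coeff (s3 31 1 0) (monomial (s3 0 0 0) 1 * h ^ 2) = 0 :=
    codd _ _ 0 (by simp [s3])
  have hs : s3 31 1 0 = 2 • s3 15 0 0 + s3 1 1 0 := by
    ext i; fin_cases i <;> simp [s3]
  simp only [z0, z1, z2, mul_zero, add_zero]
  rw [hs, ceven]

lemma ev1 (h : P 3) (hh : h.IsHomogeneous 15) :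
    coeff (s3 15 0 0) h = eval ![1, 0, 0] h := by
  rw [eval_eq', Finset.sum_eq_single (s3 15 0 0)]
  · simp [Fin.prod_univ_three, s3]
  · intro d hd hne
    have hdeg : d.degree = 15 := by
      rw [Finsupp.degree_eq_weight_one]; exact hh (mem_support_iff.1 hd)
    rw [Finsupp.degree_eq_sum, Fin.sum_univ_three] at hdeg
    rw [Fin.prod_univ_three]
    by_cases h1 : d 1 = 0
    · by_cases h2 : d 2 = 0
      · exfalso; apply hne
        ext i; fin_cases i <;> simp [s3] <;> omega
      · simp [h2]
    · simp [h1]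
  · intro hd
    rw [notMem_support_iff.1 hd, zero_mul]

/-- the functional attached to three vectors -/
def Lam (p q r : Fin 4 → ZMod 2) : P 4 →ₗ[ZMod 2] ZMod 2 :=
  T3 ∘ₗ (aeval (fun v => lf (p v) (q v) (r v)) : P 4 →ₐ[ZMod 2] P 3).toLinearMap

lemma Lam_Hd (p q r : Fin 4 → ZMod 2) : Hd 67 (Lam p q r) :=
  T3_Hd.comp _ (fun _ => lf_hom _ _ _) (fun _ => lf_sq _ _ _)

/-- permanents/minors -/
def per (p q r : Fin 4 → ZMod 2) (a b c : Fin 4) : ZMod 2 :=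
  p a * q b * r c + p a * r b * q c + q a * p b * r c + q a * r b * p c + r a * p b * q c +
    r a * q b * p c

lemma Lam_eval (p q r : Fin 4 → ZMod 2) (t : Fin 4) (U : Finset (Fin 4)) (ht : t ∈ U)
    (i k : Fin 4) : Lam p q r (mE (e4 t U i k)) =
    per p q r (i + 1) (i + 2) (i + 3) * ((p t * q k + q t * p k) * ∏ v, p v ^ rep t U v) := by
  have hw : (aeval (fun v => lf (p v) (q v) (r v)) (mE (rep t U)) : P 3).IsHomogeneous 15 := by
    have := (mE_hom (rep t U)).aeval (fun v => lf (p v) (q v) (r v)) (fun _ => lf_hom _ _ _)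
    rw [rep_dg t U ht] at this
    simpa using this
  unfold e4
  rw [mE_add, mE_cc, mE_two, mE_add, mE_add, mE_ee, mE_ee, mE_two]
  change coeff (s3 63 3 1) (aeval (fun v => lf (p v) (q v) (r v)) _) = _
  simp only [xS, map_mul, map_pow, aeval_X]
  rw [ev3, ev2, ev1 _ hw]
  congr 2
  unfold mE
  rw [mon_eq, map_prod, map_prod]
  refine Finset.prod_congr rfl fun v _ => ?_
  simp [lf]

end lower

section dual

variable {Q : Type*} [AddCommGroup Q] [Module (ZMod 2) Q]

lemma Hd.add {n d : ℕ} {φ ψ : P n →ₗ[ZMod 2] Q} (h : Hd d φ) (h' : Hd d ψ) : Hd d (φ + ψ) := by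
  constructor
  · intro a ha
    rw [LinearMap.add_apply, h.1 a ha, h'.1 a ha, add_zero]
  · intro a ha
    rw [LinearMap.add_apply, h.2 a ha, h'.2 a ha, add_zero]

/-- indicator vectors -/
def dv (k : Fin 4) : Fin 4 → ZMod 2 := fun v => if v = k then 1 else 0
def iU (U : Finset (Fin 4)) : Fin 4 → ZMod 2 := fun v => if v ∈ U then 1 else 0

/-- dual functionals -/
def Lz (t : Fin 4) (U : Finset (Fin 4)) (i k : Fin 4) : P 4 →ₗ[ZMod 2] ZMod 2 :=
  if i = k then
    Lam (iU U) (dv i + dv (i0 t)) (dv (2 - t - i - i0 t)) +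
      Lam (iU U) (dv (i0 t)) (dv (2 - t - i - i0 t)) + Lam (iU U) (dv i) (dv (2 - t - i - i0 t))
  else Lam (iU U) (dv k) (dv (2 - t - i - k))

lemma Lz_Hd (t : Fin 4) (U : Finset (Fin 4)) (i k : Fin 4) : Hd 67 (Lz t U i k) := by
  unfold Lz
  split_ifs
  · exact ((Lam_Hd _ _ _).add (Lam_Hd _ _ _)).add (Lam_Hd _ _ _)
  · exact Lam_Hd _ _ _

lemma prodU (U : Finset (Fin 4)) (t : Fin 4) (U' : Finset (Fin 4)) :
    (U' = U → ∏ v, iU U v ^ rep t U' v = if t ∈ U then 1 else ∏ v, iU U v ^ rep t U' v) ∧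
    (t ∈ U' → ¬ U' ⊆ U → ∏ v, iU U v ^ rep t U' v = 0) := by
  constructor
  · rintro rfl
    split_ifs with ht
    · refine Finset.prod_eq_one fun v _ => ?_
      unfold iU rep
      split_ifs <;> first | (subst_vars; contradiction) | simp
    · rfl
  · intro ht hU
    obtain ⟨v, hv, hv'⟩ := Finset.not_subset.1 hU
    refine Finset.prod_eq_zero (Finset.mem_univ v) ?_
    have h1 : iU U v = 0 := by simp [iU, hv']
    have h2 : 0 < rep t U' v := by
      have := mem_sp (a := rep t U') (v := v)
      rw [rep_sp t U' ht] at this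
      exact this.1 hv
    rw [h1, zero_pow h2.ne']

lemma Lz_not (t : Fin 4) (U : Finset (Fin 4)) (i k t' : Fin 4) (U' : Finset (Fin 4))
    (i' k' : Fin 4) (ht : t' ∈ U') (h : ¬ U' ⊆ U) : Lz t U i k (mE (e4 t' U' i' k')) = 0 := by
  have := (prodU U t' U').2 ht h
  unfold Lz
  split_ifs <;> simp only [LinearMap.add_apply, Lam_eval _ _ _ _ _ ht, this, mul_zero, add_zero]

def vz (p q r : Fin 4 → ZMod 2) (t i k : Fin 4) : ZMod 2 :=
  per p q r (i + 1) (i + 2) (i + 3) * (p t * q k + q t * p k)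

def fz (t : Fin 4) (U : Finset (Fin 4)) (i k i' k' : Fin 4) : ZMod 2 :=
  if i = k then
    vz (iU U) (dv i + dv (i0 t)) (dv (2 - t - i - i0 t)) t i' k' +
      vz (iU U) (dv (i0 t)) (dv (2 - t - i - i0 t)) t i' k' +
      vz (iU U) (dv i) (dv (2 - t - i - i0 t)) t i' k'
  else vz (iU U) (dv k) (dv (2 - t - i - k)) t i' k'

set_option maxRecDepth 100000 in
lemma fz_dec : ∀ t : Fin 4, ∀ U : Finset (Fin 4), t ∈ U → (∀ s ∈ U, t ≤ s) → ∀ i k,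
    val4 t U i k → ∀ i' k', val4 t U i' k' →
      fz t U i k i' k' = if i' = i ∧ k' = k then 1 else 0 := by
  decide +kernel

lemma Lz_eq (t : Fin 4) (U : Finset (Fin 4)) (i k i' k' : Fin 4) (h : val4 t U i k)
    (h' : val4 t U i' k') :
    Lz t U i k (mE (e4 t U i' k')) = if i' = i ∧ k' = k then 1 else 0 := by
  have ht := h.1
  have := (prodU U t U).1 rfl
  rw [if_pos ht] at this
  rw [← fz_dec t U h.1 h.2.1 i k h i' k' h']
  unfold Lz fz
  split_ifs <;> simp only [LinearMap.add_apply, Lam_eval _ _ _ _ _ ht, this, mul_one, vz]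

abbrev Z4 := Fin 4 × Finset (Fin 4) × Fin 4 × Fin 4

def V4 (z : Z4) : Prop := val4 z.1 z.2.1 z.2.2.1 z.2.2.2
instance (z : Z4) : Decidable (V4 z) := by unfold V4; infer_instance
def E4 (z : Z4) : Fin 4 → ℕ := e4 z.1 z.2.1 z.2.2.1 z.2.2.2
def LZ (z : Z4) : P 4 →ₗ[ZMod 2] ZMod 2 := Lz z.1 z.2.1 z.2.2.1 z.2.2.2

lemma LZ_not {z z' : Z4} (hz' : V4 z') (h : ¬ z'.2.1 ⊆ z.2.1) : LZ z (mE (E4 z')) = 0 :=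
  Lz_not _ _ _ _ _ _ _ _ hz'.1 h

lemma LZ_eq {z z' : Z4} (hz : V4 z) (hz' : V4 z') (h : z'.2.1 = z.2.1) :
    LZ z (mE (E4 z')) = if z' = z then 1 else 0 := by
  obtain ⟨t, U, i, k⟩ := z
  obtain ⟨t', U', i', k'⟩ := z'
  dsimp only at h
  subst h
  have : t' = t := le_antisymm (hz'.2.1 _ hz.1) (hz.2.1 _ hz'.1)
  subst this
  unfold LZ E4
  dsimp only
  rw [Lz_eq _ _ _ _ _ _ hz hz']
  simp

lemma LZ_self {z : Z4} (hz : V4 z) : LZ z (mE (E4 z)) = 1 := by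
  rw [LZ_eq hz hz rfl, if_pos rfl]

lemma E4_inj {z z' : Z4} (hz : V4 z) (hz' : V4 z') (h : E4 z = E4 z') : z = z' := by
  have h1 := LZ_self hz
  have h2 := LZ_self hz'
  have s1 : z.2.1 ⊆ z'.2.1 := by
    by_contra hn
    rw [← h, LZ_not hz hn] at h2
    exact zero_ne_one h2
  have s2 : z'.2.1 ⊆ z.2.1 := by
    by_contra hn
    rw [h, LZ_not hz' hn] at h1
    exact zero_ne_one h1
  by_contra hne
  rw [← h, LZ_eq hz' hz (s1.antisymm s2), if_neg hne] at h2
  exact zero_ne_one h2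

/-- position of `w` after deleting `j` -/
def pos (j w : Fin 5) : Fin 4 :=
  if h : w < j then ⟨w, by omega⟩ else ⟨w - 1, by omega⟩

lemma pos_sA (j : Fin 5) (v : Fin 4) : pos j (j.succAbove v) = v := by
  revert j v; decide

lemma sA_pos (j w : Fin 5) (h : w ≠ j) : j.succAbove (pos j w) = w := by
  revert j w; decide

def b5 (j : Fin 5) (a : Fin 4 → ℕ) : Fin 5 → ℕ := fun w => if w = j then 0 else a (pos j w)

lemma b5_self (j : Fin 5) (a : Fin 4 → ℕ) : b5 j a j = 0 := by simp [b5]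

lemma b5_sA (j : Fin 5) (a : Fin 4 → ℕ) (v : Fin 4) : b5 j a (j.succAbove v) = a v := by
  simp [b5, pos_sA]

lemma b5_inj {j : Fin 5} {a a' : Fin 4 → ℕ} (h : b5 j a = b5 j a') : a = a' := by
  ext v
  rw [← b5_sA j a v, h, b5_sA]

def pm (j j' : Fin 5) (v : Fin 4) : Fin 4 := pos j (Equiv.swap j j' (j'.succAbove v))

def wz (j j' : Fin 5) (z : Z4) : Z4 :=
  (pm j j' z.1, z.2.1.image (pm j j'), pm j j' z.2.2.1, pm j j' z.2.2.2)

def Cq (j' j : Fin 5) (z : Z4) : Prop :=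
  V4 (wz j j' z) ∧ ∀ w, b5 j' (E4 z) w = b5 j (E4 (wz j j' z)) w

instance (j' j : Fin 5) (z : Z4) : Decidable (Cq j' j z) := by unfold Cq; infer_instance

set_option synthInstance.maxSize 1000 in
set_option synthInstance.maxHeartbeats 400000 in
set_option maxRecDepth 100000 in
lemma cons_dec : ∀ t : Fin 4, ∀ U : Finset (Fin 4), t ∈ U → (∀ s ∈ U, t ≤ s) → ∀ i k,
    val4 t U i k → ∀ j' j, j ≠ j' → b5 j' (e4 t U i k) j = 0 →
      Cq j' j (t, U, i, k) := by
  decide +kernel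

lemma cons (j' j : Fin 5) (z : Z4) (hz : V4 z) (h : b5 j' (E4 z) j = 0) :
    ∃ z', V4 z' ∧ b5 j' (E4 z) = b5 j (E4 z') := by
  by_cases hj : j = j'
  · subst hj; exact ⟨z, hz, rfl⟩
  · obtain ⟨h1, h2⟩ := cons_dec z.1 z.2.1 hz.1 hz.2.1 z.2.2.1 z.2.2.2 hz j' j hj h
    exact ⟨_, h1, funext h2⟩

def I5p (j : Fin 5) (z : Z4) : Prop := V4 z ∧ ∀ j', j' < j → b5 j (E4 z) j' ≠ 0

instance (j : Fin 5) (z : Z4) : Decidable (I5p j z) := by unfold I5p; infer_instance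

abbrev I5 := {x : Fin 5 × Z4 // I5p x.1 x.2}

set_option maxRecDepth 100000 in
lemma card_I5 : Fintype.card I5 = 460 := by
  decide +kernel

def bv (x : I5) : Fin 5 → ℕ := b5 x.1.1 (E4 x.1.2)

lemma bv_inj {x y : I5} (h : bv x = bv y) : x = y := by
  obtain ⟨⟨j, z⟩, hz, hj⟩ := x
  obtain ⟨⟨j', z'⟩, hz', hj'⟩ := y
  unfold bv at h
  dsimp only at h hz hj hz' hj'
  have e : j = j' := by
    rcases lt_trichotomy j j' with hl | hl | hl
    · exact absurd (by rw [← h, b5_self]) (hj' j hl)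
    · exact hl
    · exact absurd (by rw [h, b5_self]) (hj j' hl)
  subst e
  have := E4_inj hz hz' (b5_inj h)
  subst this
  rfl

lemma bv_surj (j : Fin 5) (z : Z4) (hz : V4 z) : ∃ x : I5, bv x = b5 j (E4 z) := by
  have hne : ∃ j' : Fin 5, b5 j (E4 z) j' = 0 := ⟨j, b5_self _ _⟩
  obtain ⟨j0, h0, hm⟩ : ∃ j0 : Fin 5, b5 j (E4 z) j0 = 0 ∧ ∀ j' < j0, b5 j (E4 z) j' ≠ 0 := by
    obtain ⟨m, hm⟩ := exists_minimal_of_wellFoundedLT (fun w => b5 j (E4 z) w = 0) hne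
    exact ⟨m, hm.1, fun j' hj' h => absurd (hm.2 h hj'.le) (not_le.2 hj')⟩
  obtain ⟨z', hz', h⟩ := cons j j0 z hz h0
  exact ⟨⟨(j0, z'), hz', fun j' hj' => by rw [← h]; exact hm j' hj'⟩, h.symm⟩

end dual

section final

variable {Q : Type*} [AddCommGroup Q] [Module (ZMod 2) Q]

def m5 (b : Fin 5 → ℕ) : P 5 := mono (Finsupp.equivFunOnFinite.symm b)

lemma m5_prod (b : Fin 5 → ℕ) : m5 b = ∏ w, X w ^ b w := by
  unfold m5 mono; rw [mon_eq]; simp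

lemma mE_prod (b : Fin 4 → ℕ) : mE b = ∏ w, X w ^ b w := by
  unfold mE; rw [mon_eq]; simp

/-- delete the variable `j` -/
def dl (j w : Fin 5) : P 4 := if w = j then 0 else X (pos j w)

lemma dl_hom (j w : Fin 5) : (dl j w).IsHomogeneous 1 := by
  unfold dl; split_ifs
  · exact isHomogeneous_zero _ _ _
  · exact isHomogeneous_X _ _

lemma dl_sq (j w : Fin 5) : SqT 4 (dl j w) = dl j w + dl j w ^ 2 := by
  unfold dl; split_ifs
  · simp
  · exact sqT_X _

lemma dl_m5 (j : Fin 5) (b : Fin 5 → ℕ) :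
    aeval (dl j) (m5 b) = if b j = 0 then mE (fun v => b (j.succAbove v)) else 0 := by
  rw [m5_prod, map_prod, Fin.prod_univ_succAbove _ j]
  simp only [map_pow, aeval_X]
  have h1 : dl j j = 0 := by simp [dl]
  have h2 : ∀ v, dl j (j.succAbove v) = X v := by intro v; simp [dl, pos_sA]
  simp only [h1, h2]
  split_ifs with h
  · rw [h, pow_zero, one_mul, mE_prod]
  · rw [zero_pow h, zero_mul]

lemma dl_b5 (j : Fin 5) (a : Fin 4 → ℕ) : aeval (dl j) (m5 (b5 j a)) = mE a := by
  rw [dl_m5, if_pos (b5_self _ _)]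
  simp only [b5_sA]

lemma ins_m5 (j : Fin 5) (a : Fin 4 → ℕ) :
    aeval (fun v => (X (j.succAbove v) : P 5)) (mE a) = m5 (b5 j a) := by
  rw [m5_prod, mE_prod, map_prod, Fin.prod_univ_succAbove _ j, b5_self, pow_zero, one_mul]
  simp [b5_sA]

def PsiZ (j : Fin 5) (z : Z4) : P 5 →ₗ[ZMod 2] ZMod 2 :=
  LZ z ∘ₗ (aeval (dl j) : P 5 →ₐ[ZMod 2] P 4).toLinearMap

lemma PsiZ_apply (j : Fin 5) (z : Z4) (f : P 5) : PsiZ j z f = LZ z (aeval (dl j) f) := rfl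

lemma PsiZ_Hd (j : Fin 5) (z : Z4) : Hd 67 (PsiZ j z) :=
  (Lz_Hd _ _ _ _).comp _ (dl_hom j) (dl_sq j)

/-- class map as a linear map -/
def clsL : P 5 →ₗ[ZMod 2] QP 5 67 :=
  ((hitSub 5 67).comap (homSub 5 67).subtype).mkQ ∘ₗ
    (homogeneousComponent 67).codRestrict (homSub 5 67) fun f =>
      (mem_homogeneousSubmodule _ _).2 (homogeneousComponent_isHomogeneous 67 f)

lemma clsL_hit {f : P 5} (h : homogeneousComponent 67 f ∈ hitSub 5 67) : clsL f = 0 := by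
  unfold clsL
  rw [LinearMap.comp_apply, Submodule.mkQ_apply, Submodule.Quotient.mk_eq_zero]
  exact h

lemma clsL_Hd : Hd 67 clsL := by
  constructor
  · intro a ha
    apply clsL_hit
    rw [homogeneousComponent_of_mem (homM a), if_neg (Ne.symm ha)]
    exact zero_mem _
  · intro a ha
    apply clsL_hit
    apply Submodule.subset_span
    refine ⟨fun i => if i = 67 - a.degree then monomial a 1 else 0, ?_, ?_⟩
    · intro i
      dsimp only
      split_ifs with h
      · have := homM a
        rw [show a.degree = 67 - i by omega] at this
        exact (mem_homogeneousSubmodule _ _).2 this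
      · exact zero_mem _
    · rw [Finset.sum_eq_single (67 - a.degree)]
      · dsimp only; rw [if_pos rfl]
      · intro i _ hi
        dsimp only; rw [if_neg hi, map_zero, map_zero]
      · intro h
        exact absurd (Finset.mem_Icc.2 ⟨by omega, by omega⟩) h

lemma descend {φ : P 5 →ₗ[ZMod 2] Q} (hφ : Hd 67 φ) :
    ∃ g : QP 5 67 →ₗ[ZMod 2] Q, ∀ f, g (clsL f) = φ f := by
  refine ⟨Submodule.liftQ _ (φ ∘ₗ (homSub 5 67).subtype) ?_, ?_⟩
  · intro u hu
    exact hφ.hit hu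
  · intro f
    exact hφ.1.comp_hom f

def cv (x : I5) : QP 5 67 := clsL (m5 (bv x))

lemma cv_indep : LinearIndependent (ZMod 2) cv := by
  rw [Fintype.linearIndependent_iff]
  intro c hc
  have key : ∀ j z, ∑ x, c x * PsiZ j z (m5 (bv x)) = 0 := by
    intro j z
    obtain ⟨g, hg⟩ := descend (PsiZ_Hd j z)
    have := congrArg g hc
    rw [map_sum, map_zero] at this
    rw [← this]
    refine Finset.sum_congr rfl fun x _ => ?_
    rw [map_smul, cv, hg, smul_eq_mul]
  have main : ∀ m, ∀ (j : Fin 5) (z : Z4), V4 z → z.2.1.card = m → ∀ x, bv x = b5 j (E4 z) →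
      c x = 0 := by
    intro m
    induction m using Nat.strong_induction_on with
    | _ m ih =>
    intro j z hz hm x hx
    have h := key j z
    rw [Finset.sum_eq_single x] at h
    · rwa [hx, PsiZ_apply, dl_b5, LZ_self hz, mul_one] at h
    · intro y _ hy
      by_cases h0 : bv y j = 0
      · obtain ⟨z', hz', e⟩ := cons y.1.1 j y.1.2 y.2.1 h0
        have e : bv y = b5 j (E4 z') := e
        by_cases hs : z'.2.1 ⊆ z.2.1
        · rcases hs.eq_or_ssubset with hs | hs
          · rw [e, PsiZ_apply, dl_b5, LZ_eq hz hz' hs, if_neg, mul_zero]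
            rintro rfl
            exact hy (bv_inj (e.trans hx.symm))
          · have := Finset.card_lt_card hs
            rw [ih _ (by omega) j z' hz' rfl y e, zero_mul]
        · rw [e, PsiZ_apply, dl_b5, LZ_not hz' hs, mul_zero]
      · rw [PsiZ_apply, dl_m5, if_neg h0, map_zero, mul_zero]
    · intro h; exact absurd (Finset.mem_univ _) h
  intro x
  exact main _ x.1.1 x.1.2 x.2.1 rfl x rfl

lemma mono_mem (a : Fin 5 →₀ ℕ) (j : Fin 5) (hj : a j = 0) :
    clsL (mono a) ∈ Submodule.span (ZMod 2) (Set.range cv) := by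
  set S := Submodule.span (ZMod 2) (Set.range cv) with hS
  have h0 : Hd 67 (S.mkQ ∘ₗ clsL) := by
    constructor
    · intro a ha
      rw [LinearMap.comp_apply, clsL_Hd.1 a ha, map_zero]
    · intro a ha
      rw [LinearMap.comp_apply, clsL_Hd.2 a ha, map_zero]
  have h1 := h0.comp (fun v => (X (j.succAbove v) : P 5)) (fun _ => isHomogeneous_X _ _)
    (fun _ => sqT_X _)
  have h2 := upper4 h1 (fun t U i k hv => by
    obtain ⟨x, hx⟩ := bv_surj j (t, U, i, k) hv
    change S.mkQ (clsL (aeval (fun v => (X (j.succAbove v) : P 5)) (mE (E4 (t, U, i, k))))) = 0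
    rw [ins_m5, ← hx, Submodule.mkQ_apply, Submodule.Quotient.mk_eq_zero]
    exact Submodule.subset_span ⟨x, rfl⟩) (mE (fun v => a (j.succAbove v)))
  change S.mkQ (clsL (aeval (fun v => (X (j.succAbove v) : P 5)) _)) = 0 at h2
  rw [ins_m5, Submodule.mkQ_apply, Submodule.Quotient.mk_eq_zero] at h2
  have e : m5 (b5 j fun v => a (j.succAbove v)) = mono a := by
    unfold m5
    congr 1
    ext w
    rw [Finsupp.equivFunOnFinite_symm_apply_apply]
    by_cases hw : w = j
    · rw [hw, b5_self, hj]
    · rw [b5, if_neg hw, sA_pos _ _ hw]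
  rwa [e] at h2

lemma E4_dg (z : Z4) (hz : V4 z) : dg (E4 z) = 67 := by
  unfold E4 e4
  rw [dg_add, dg_two, dg_add, dg_add, dg_two, dg_ee, dg_ee, dg_cc, rep_dg _ _ hz.1]

lemma m5_hom (x : I5) : (m5 (bv x)).IsHomogeneous 67 := by
  have := homM (Finsupp.equivFunOnFinite.symm (bv x))
  rw [deg_fun, Fin.sum_univ_succAbove _ x.1.1] at this
  unfold bv at this
  rw [b5_self, zero_add] at this
  simp only [b5_sA] at this
  have h := E4_dg _ x.2.1
  unfold dg at h
  rw [h] at this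
  exact this

lemma clsL_hom (u : homSub 5 67) :
    clsL u = ((hitSub 5 67).comap (homSub 5 67).subtype).mkQ u := by
  unfold clsL
  rw [LinearMap.comp_apply]
  congr 1
  ext1
  rw [LinearMap.codRestrict_apply, homogeneousComponent_of_mem u.2, if_pos rfl]

lemma Qzero_eq : Qzero 5 67 = Submodule.span (ZMod 2) (Set.range cv) := by
  apply le_antisymm
  · unfold Qzero
    rw [Submodule.map_le_iff_le_comap]
    intro u hu
    have h : PzeroSub 5 ≤ (Submodule.span (ZMod 2) (Set.range cv)).comap clsL := by
      unfold PzeroSub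
      rw [Submodule.span_le]
      rintro _ ⟨a, ⟨j, hj⟩, rfl⟩
      exact mono_mem a j hj
    rw [Submodule.mem_comap, ← clsL_hom]
    exact h hu
  · rw [Submodule.span_le]
    rintro _ ⟨x, rfl⟩
    unfold Qzero
    refine ⟨⟨m5 (bv x), (mem_homogeneousSubmodule _ _).2 (m5_hom x)⟩, ?_, ?_⟩
    · apply Submodule.subset_span
      refine ⟨_, ⟨x.1.1, ?_⟩, rfl⟩
      exact b5_self _ _
    · rw [← clsL_hom]
      rfl

end final

/-- `(QP_5^0)_67` has dimension `460` over `𝔽₂`. -/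
theorem statement1 : Module.finrank (ZMod 2) (Qzero 5 67) = 460 := by
  rw [Qzero_eq, finrank_span_eq_card cv_indep, card_I5]


end
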